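/- If Φ is a contractive Schur idempotent on B(H), then Φ ∈ 𝔉H and λ(Φ) ≤ 2; that is, ‖T − Φ(T)‖ ≤ 2·α(T, ran Φ) for every T ∈ B(H). -/

import Mathlib

open scoped InnerProductSpace Pointwise

noncomputable section

namespace SchurHyper

/-- `B H` is the algebra of bounded linear operators on `H`. -/
abbrev B (H : Type*) [NormedAddCommGroup H] [InnerProductSpace ℂ H] : Type _ := H →L[ℂ] H

variable (H : Type*) [NormedAddCommGroup H] [InnerProductSpace ℂ H]

/-- A linear functional on `B H` is *normal* (weak* continuous) if it arises from
the duality with the trace class, i.e. it is of the form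
`T ↦ ∑ₙ ⟪yₙ, T xₙ⟫` for square-summable sequences `(xₙ)`, `(yₙ)`
(recall that the inner product is conjugate-linear in its first slot). -/
def IsNormalFunctional (ω : B H →ₗ[ℂ] ℂ) : Prop :=
  ∃ x y : ℕ → H, Summable (fun n => ‖x n‖ ^ 2) ∧ Summable (fun n => ‖y n‖ ^ 2) ∧
    ∀ T : B H, ω T = ∑' n, ⟪y n, T (x n)⟫_ℂ

/-- The weak* topology on `B H`: the topology induced by the normal functionals. -/
def weakStarTopology : TopologicalSpace (B H) :=
  TopologicalSpace.induced
    (fun (T : B H) (ω : {ω : B H →ₗ[ℂ] ℂ // IsNormalFunctional H ω}) => ω.1 T)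
    inferInstance

/-- A set of operators is weak* closed if it is closed in the weak* topology. -/
def WStarClosed (X : Set (B H)) : Prop := @IsClosed _ (weakStarTopology H) X

/-- The weak* closure of a set of operators. -/
def wStarClosure (X : Set (B H)) : Set (B H) := @closure _ (weakStarTopology H) X

/-- A map on `B H` is weak* continuous if it is continuous with respect to the
weak* topology on both sides. -/
def WStarContinuous (Φ : B H →L[ℂ] B H) : Prop :=
  @Continuous _ _ (weakStarTopology H) (weakStarTopology H) Φ

variable {H}
variable [CompleteSpace H]

/-- A maximal abelian selfadjoint subalgebra of `B H`: an abelian selfadjoint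
subalgebra which contains every operator commuting with it (equivalently, it
coincides with its own commutant). -/
def IsMasa (D : StarSubalgebra ℂ (B H)) : Prop :=
  (∀ A ∈ D, ∀ C ∈ D, A * C = C * A) ∧
  (∀ T : B H, (∀ A ∈ D, T * A = A * T) → T ∈ D)

/-- A Schur multiplier: a weak* continuous `D`-bimodule map on `B H`. -/
def IsSchurMultiplier (D : StarSubalgebra ℂ (B H)) (Φ : B H →L[ℂ] B H) : Prop :=
  WStarContinuous H Φ ∧ ∀ A ∈ D, ∀ C ∈ D, ∀ T : B H, Φ (A * T * C) = A * Φ T * C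

/-- A Schur idempotent: an idempotent Schur multiplier. -/
def IsSchurIdempotent (D : StarSubalgebra ℂ (B H)) (Φ : B H →L[ℂ] B H) : Prop :=
  IsSchurMultiplier D Φ ∧ Φ.comp Φ = Φ

/-- A subspace `X ⊆ B H` is a `D`-bimodule if `D X D ⊆ X`. -/
def IsBimodule (D : StarSubalgebra ℂ (B H)) (X : Submodule ℂ (B H)) : Prop :=
  ∀ A ∈ D, ∀ C ∈ D, ∀ T ∈ X, A * T * C ∈ X

/-- The Arveson distance `α(T, X)`. -/
def arveson (T : B H) (X : Set (B H)) : ℝ :=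
  ⨆ ξ : {ξ : H // ‖ξ‖ = 1}, ⨅ S : X, ‖T ξ.1 - S.1 ξ.1‖

/-- The set of hyperreflexivity constants of `X`. -/
def hyperSet (X : Set (B H)) : Set ℝ :=
  {k | 0 < k ∧ ∀ T : B H, Metric.infDist T X ≤ k * arveson T X}

/-- A subspace is hyperreflexive if `d(T, X) ≤ k ⬝ α(T, X)` for some `k > 0`. -/
def Hyperreflexive (X : Set (B H)) : Prop := (hyperSet X).Nonempty

/-- The hyperreflexivity constant `k(X)`: the least constant that works. -/
def hyperConst (X : Set (B H)) : ℝ := sInf (hyperSet X)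

/-- The set of constants `λ` witnessing that a Schur idempotent lies in `𝔉H`. -/
def lamSet (Φ : B H →L[ℂ] B H) : Set ℝ :=
  {l | 0 < l ∧ ∀ T : B H, ‖T - Φ T‖ ≤ l * arveson T (Set.range Φ)}

/-- The class `𝔉H` of Schur idempotents `Φ` such that
`‖T - Φ T‖ ≤ λ ⬝ α(T, ran Φ)` for some `λ > 0` and all `T`. -/
def MemFH (D : StarSubalgebra ℂ (B H)) (Φ : B H →L[ℂ] B H) : Prop :=
  IsSchurIdempotent D Φ ∧ (lamSet Φ).Nonempty

/-- The constant `λ(Φ)`: the least constant witnessing membership of `𝔉H`. -/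
def lam (Φ : B H →L[ℂ] B H) : ℝ := sInf (lamSet Φ)

/-- A ternary masa-bimodule condition: `S T* R ∈ M` whenever `S, T, R ∈ M`. -/
def IsTernary (M : Submodule ℂ (B H)) : Prop :=
  ∀ S ∈ M, ∀ T ∈ M, ∀ R ∈ M, S * star T * R ∈ M

end SchurHyper

open SchurHyper

section

variable {H : Type*} [NormedAddCommGroup H] [InnerProductSpace ℂ H] [CompleteSpace H]

/-- The projection onto a closed subspace reducing an operator commutes with it. -/
theorem starProjection_commute_of_reducing {K : Submodule ℂ H} [K.HasOrthogonalProjection]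
    {A : B H} (hA : ∀ v ∈ K, A v ∈ K) (hA' : ∀ v ∈ K, star A v ∈ K) :
    K.starProjection * A = A * K.starProjection := by
  ext v
  simp only [mul_apply_eq_comp]
  apply Submodule.eq_starProjection_of_mem_of_inner_eq_zero (hA _ (K.starProjection_apply_mem v))
  intro w hw
  rw [← map_sub, ← ContinuousLinearMap.adjoint_inner_right]
  exact Submodule.starProjection_inner_eq_zero v _ (hA' w hw)

/-- The projection onto a closed `D`-invariant subspace lies in the masa `D`. -/
theorem SchurHyper.IsMasa.starProjection_mem {D : StarSubalgebra ℂ (B H)} (hD : IsMasa D)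
    {K : Submodule ℂ H} [K.HasOrthogonalProjection] (hK : ∀ A ∈ D, ∀ v ∈ K, A v ∈ K) :
    K.starProjection ∈ D :=
  hD.2 _ fun A hA =>
    starProjection_commute_of_reducing (hK A hA) (hK (star A) (star_mem hA))

/-- The projection onto the closure of the range of an element of a masa. -/
theorem SchurHyper.IsMasa.exists_range_projection {D : StarSubalgebra ℂ (B H)} (hD : IsMasa D)
    {A : B H} (hA : A ∈ D) :
    ∃ F ∈ D, IsStarProjection F ∧ F * A = A ∧ ∀ C : B H, C * A = 0 → C * F = 0 := by
  set K : Submodule ℂ H := (LinearMap.range A.toLinearMap).topologicalClosure with hKdef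
  have hclosed : IsClosed (K : Set H) := Submodule.isClosed_topologicalClosure _
  have : CompleteSpace K := hclosed.completeSpace_coe
  have hind : ∀ C : B H, ∀ L : Submodule ℂ H, IsClosed (L : Set H) →
      (∀ v, C (A v) ∈ L) → ∀ v ∈ K, C v ∈ L := by
    intro C L hL h v hv
    have : K ≤ L.comap C.toLinearMap := by
      apply Submodule.topologicalClosure_minimal
      · rintro _ ⟨w, rfl⟩
        exact h w
      · exact hL.preimage C.continuous
    exact this hv
  refine ⟨K.starProjection, hD.starProjection_mem ?_, isStarProjection_starProjection, ?_, ?_⟩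
  · intro C hC
    refine hind C K hclosed fun v => Submodule.le_topologicalClosure _ ⟨C v, ?_⟩
    exact congrArg (fun T : B H => T v) (hD.1 A hA C hC)
  · ext v
    exact Submodule.starProjection_eq_self_iff.2
      (Submodule.le_topologicalClosure _ ⟨v, rfl⟩)
  · intro C hC
    ext v
    have := hind C ⊥ (by simp) (fun v => by
      simpa using congrArg (fun T : B H => T v) hC) _ (K.starProjection_apply_mem v)
    simpa using this

/-- Spectral cut of a self-adjoint element of a masa at `0`. -/
theorem SchurHyper.IsMasa.exists_cut {D : StarSubalgebra ℂ (B H)} (hD : IsMasa D)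
    {A : B H} (hA : A ∈ D) (hsa : IsSelfAdjoint A) :
    ∃ F ∈ D, IsStarProjection F ∧ F * A = A⁺ ∧ F * A⁺ = A⁺ ∧ F * A⁻ = 0 := by
  have hpos : A⁺ ∈ D := hD.2 _ fun C hC =>
    (Commute.cfcₙ_real (show Commute A C from hD.1 A hA C hC) _)
  have hneg : A⁻ ∈ D := hD.2 _ fun C hC =>
    (Commute.cfcₙ_real (show Commute A C from hD.1 A hA C hC) _)
  obtain ⟨F, hF, hFp, h1, h2⟩ := hD.exists_range_projection hpos
  have h3 : F * A⁻ = 0 := by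
    rw [hD.1 F hF _ hneg]
    exact h2 _ (CFC.negPart_mul_posPart A)
  refine ⟨F, hF, hFp, ?_, h1, h3⟩
  nth_rw 1 [← CFC.posPart_sub_negPart A hsa]
  rw [mul_sub, h1, h3, sub_zero]

/-- The form version of the spectral cut at level `t`. -/
theorem SchurHyper.IsMasa.exists_form_cut {D : StarSubalgebra ℂ (B H)} (hD : IsMasa D)
    {A : B H} (hA : A ∈ D) (hsa : IsSelfAdjoint A) (t : ℝ) :
    ∃ F ∈ D, IsStarProjection F ∧
      (∀ v, F v = v → t * ‖v‖ ^ 2 ≤ (⟪v, A v⟫_ℂ).re) ∧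
      (∀ v, F v = 0 → (⟪v, A v⟫_ℂ).re ≤ t * ‖v‖ ^ 2) := by
  have ht : (algebraMap ℝ (B H) t) ∈ D := by
    rw [IsScalarTower.algebraMap_apply ℝ ℂ (B H)]
    exact D.algebraMap_mem _
  have hsa' : IsSelfAdjoint (A - algebraMap ℝ (B H) t) :=
    hsa.sub (IsSelfAdjoint.algebraMap _ (IsSelfAdjoint.all t))
  obtain ⟨F, hF, hFp, h1, h2, h3⟩ := hD.exists_cut (sub_mem hA ht) hsa'
  set Q := A - algebraMap ℝ (B H) t with hQ
  have key : ∀ v, (⟪v, Q v⟫_ℂ).re = (⟪v, A v⟫_ℂ).re - t * ‖v‖ ^ 2 := by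
    intro v
    have : (algebraMap ℝ (B H) t) v = (t : ℂ) • v := by
      simp [Algebra.algebraMap_eq_smul_one]
    rw [hQ, sub_apply, inner_sub_right, this, inner_smul_right,
      inner_self_eq_norm_sq_to_K]
    simp [← Complex.ofReal_pow]
  have hFadj : ∀ u w, ⟪F u, w⟫_ℂ = ⟪u, F w⟫_ℂ := fun u w => by
    rw [← ContinuousLinearMap.adjoint_inner_right]
    congr 1
    exact congrArg (fun T : B H => T w) hFp.isSelfAdjoint
  refine ⟨F, hF, hFp, fun v hv => ?_, fun v hv => ?_⟩
  · have hp := (ContinuousLinearMap.nonneg_iff_isPositive _).1 (CFC.posPart_nonneg Q)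
    have : ⟪v, Q v⟫_ℂ = ⟪v, Q⁺ v⟫_ℂ := by
      conv_lhs => rw [← hv, hFadj]
      rw [hv, ← h1]; rfl
    have h4 := hp.re_inner_nonneg_right v
    rw [← this] at h4
    have := key v
    change 0 ≤ (⟪v, Q v⟫_ℂ).re at h4
    linarith
  · have hp := (ContinuousLinearMap.nonneg_iff_isPositive _).1 (CFC.negPart_nonneg Q)
    have : ⟪v, Q v⟫_ℂ = - ⟪v, Q⁻ v⟫_ℂ := by
      nth_rw 1 [← CFC.posPart_sub_negPart Q hsa']
      rw [sub_apply, inner_sub_right, ← h2,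
        mul_apply_eq_comp, ← hFadj, hv, inner_zero_left, zero_sub]
    have h4 := hp.re_inner_nonneg_right v
    have h5 : 0 ≤ (⟪v, Q⁻ v⟫_ℂ).re := h4
    have := key v
    rw [‹⟪v, Q v⟫_ℂ = _›, Complex.neg_re] at this
    linarith

/-- A self-adjoint element of a masa is halved in size by subtracting a symmetry. -/
theorem SchurHyper.IsMasa.exists_symmetry_approx {D : StarSubalgebra ℂ (B H)} (hD : IsMasa D)
    {A : B H} (hA : A ∈ D) (hsa : IsSelfAdjoint A) {M : ℝ} (hM : ‖A‖ ≤ M) :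
    ∃ F ∈ D, IsStarProjection F ∧ ‖A - ((M / 2 : ℝ) : ℂ) • (2 * F - 1)‖ ≤ M / 2 := by
  obtain ⟨F, hF, hFp, h1, h2, h3⟩ := hD.exists_cut hA hsa
  refine ⟨F, hF, hFp, ?_⟩
  have hM0 : 0 ≤ M := (norm_nonneg _).trans hM
  have hff : F * F = F := hFp.isIdempotentElem
  have hUU : (2 * F - 1) * (2 * F - 1) = 1 := by
    have : (2 * F - 1) * (2 * F - 1) = 4 * (F * F) - 4 * F + 1 := by noncomm_ring
    rw [this, hff]; simp
  have hU : ‖2 * F - 1‖ ≤ 1 := by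
    have hs : star (2 * F - 1) = 2 * F - 1 := by
      have := hFp.isSelfAdjoint.star_eq
      rw [two_mul, star_sub, star_add, this, star_one]
    have : ‖star (2 * F - 1) * (2 * F - 1)‖ = _ := CStarRing.norm_star_mul_self
    rw [hs, hUU] at this
    have h1 : ‖(1 : B H)‖ ≤ 1 := ContinuousLinearMap.norm_id_le
    nlinarith [norm_nonneg (2 * F - 1)]
  have habs : (2 * F - 1) * A = CFC.abs A := by
    rw [← CFC.posPart_add_negPart A hsa, sub_mul, mul_assoc, h1, one_mul, two_mul]
    nth_rw 3 [← CFC.posPart_sub_negPart A hsa]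
    abel
  have hdiff : A - ((M / 2 : ℝ) : ℂ) • (2 * F - 1) =
      (2 * F - 1) * (CFC.abs A - ((M / 2 : ℝ) : ℂ) • 1) := by
    rw [← habs, mul_sub, ← mul_assoc, hUU, one_mul, mul_smul_comm, mul_one]
  have hcfc : CFC.abs A - ((M / 2 : ℝ) : ℂ) • (1 : B H) = cfc (fun x : ℝ => ‖x‖ - M / 2) A := by
    rw [cfc_sub (fun x : ℝ => ‖x‖) (fun _ => M / 2) A, cfc_const (M / 2) A hsa,
      CFC.abs_eq_cfc_norm A hsa, Algebra.algebraMap_eq_smul_one]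
    congr 1
  rw [hdiff, hcfc]
  refine (norm_mul_le _ _).trans ?_
  have : ‖cfc (fun x : ℝ => ‖x‖ - M / 2) A‖ ≤ M / 2 := by
    refine norm_cfc_le (by linarith) fun x hx => ?_
    have hx' : ‖x‖ ≤ M := by
      refine (spectrum.norm_le_norm_mul_of_mem hx).trans ?_
      have h1 : ‖(1 : B H)‖ ≤ 1 := ContinuousLinearMap.norm_id_le
      nlinarith [norm_nonneg A, norm_nonneg (1 : B H)]
    rw [Real.norm_eq_abs, abs_le]
    constructor <;> linarith [norm_nonneg x]
  calc _ ≤ 1 * (M / 2) := by gcongr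
    _ = _ := one_mul _

/-- A family of mutually orthogonal projections in `D`. -/
structure IsProjFamily (D : StarSubalgebra ℂ (B H)) {J : Type} (e : J → B H) : Prop where
  mem : ∀ j, e j ∈ D
  proj : ∀ j, IsStarProjection (e j)
  ortho : ∀ i j, i ≠ j → e i * e j = 0

/-- A finite partition of the identity into orthogonal projections in `D`. -/
structure IsProjPartition (D : StarSubalgebra ℂ (B H)) {J : Type} [Fintype J] (e : J → B H) :
    Prop extends IsProjFamily D e where
  sum_eq_one : ∑ j, e j = 1

theorem IsStarProjection.mul_mem_masa {D : StarSubalgebra ℂ (B H)} (hD : IsMasa D) {P Q : B H}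
    (hP : IsStarProjection P) (hPD : P ∈ D) (hQ : IsStarProjection Q) (hQD : Q ∈ D) :
    IsStarProjection (P * Q) :=
  hP.mul hQ (hD.1 P hPD Q hQD)

theorem IsProjPartition.one (D : StarSubalgebra ℂ (B H)) :
    IsProjPartition D (fun _ : Unit => (1 : B H)) where
  mem _ := one_mem D
  proj _ := .one _
  ortho i j h := (h (Subsingleton.elim i j)).elim
  sum_eq_one := by simp

/-- The partition into a projection and its complement. -/
theorem IsProjPartition.bool {D : StarSubalgebra ℂ (B H)} {F : B H} (hF : F ∈ D)
    (hFp : IsStarProjection F) : IsProjPartition D (fun b : Bool => if b then F else 1 - F) where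
  mem b := by cases b <;> simp [hF, sub_mem, one_mem]
  proj b := by cases b <;> simp [hFp, hFp.one_sub]
  ortho i j h := by
    cases i <;> cases j <;> simp [hFp.mul_one_sub_self, hFp.one_sub_mul_self] at h ⊢
  sum_eq_one := by simp

/-- The common refinement of two partitions. -/
theorem IsProjPartition.mul {D : StarSubalgebra ℂ (B H)} (hD : IsMasa D) {J K : Type} [Fintype J]
    [Fintype K] {e : J → B H} {f : K → B H} (he : IsProjPartition D e) (hf : IsProjPartition D f) :
    IsProjPartition D (fun p : J × K => e p.1 * f p.2) where
  mem p := mul_mem (he.mem _) (hf.mem _)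
  proj p := (he.proj _).mul_mem_masa hD (he.mem _) (hf.proj _) (hf.mem _)
  ortho p q h := by
    have hc : e p.1 * f p.2 * (e q.1 * f q.2) = (e p.1 * e q.1) * (f p.2 * f q.2) := by
      rw [mul_assoc, ← mul_assoc (f p.2), hD.1 _ (hf.mem p.2) _ (he.mem q.1)]
      simp only [mul_assoc]
    rw [hc]
    by_cases h1 : p.1 = q.1
    · have h2 : p.2 ≠ q.2 := fun h2 => h (Prod.ext h1 h2)
      rw [hf.ortho _ _ h2, mul_zero]
    · rw [he.ortho _ _ h1, zero_mul]
  sum_eq_one := by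
    rw [Fintype.sum_prod_type]
    simp [← Finset.mul_sum, hf.sum_eq_one, he.sum_eq_one]

/-- A self-adjoint element of a masa is nearly scalar on the pieces of a finite partition. -/
theorem SchurHyper.IsMasa.exists_partition_of_isSelfAdjoint {D : StarSubalgebra ℂ (B H)}
    (hD : IsMasa D) (k : ℕ) : ∀ {A : B H}, A ∈ D → IsSelfAdjoint A → ∀ {M : ℝ}, ‖A‖ ≤ M →
    ∃ (J : Type) (_ : Fintype J) (e : J → B H) (l : J → ℂ), IsProjPartition D e ∧
      ∀ j, ‖(A - l j • 1) * e j‖ ≤ M / 2 ^ k := by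
  induction k with
  | zero =>
    intro A hA hsa M hM
    exact ⟨Unit, inferInstance, fun _ => 1, fun _ => 0, .one D, fun _ => by simpa using hM⟩
  | succ k ih =>
    intro A hA hsa M hM
    obtain ⟨F, hF, hFp, hn⟩ := hD.exists_symmetry_approx hA hsa hM
    have h2F : 2 * F - 1 ∈ D := by
      rw [two_mul]
      exact sub_mem (add_mem hF hF) (one_mem D)
    have hs : IsSelfAdjoint (2 * F - 1) := by
      rw [two_mul]
      exact (hFp.isSelfAdjoint.add hFp.isSelfAdjoint).sub (.one _)
    have hmem : A - ((M / 2 : ℝ) : ℂ) • (2 * F - 1) ∈ D :=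
      sub_mem hA (D.smul_mem h2F _)
    have hsa' : IsSelfAdjoint (A - ((M / 2 : ℝ) : ℂ) • (2 * F - 1)) := by
      refine hsa.sub (IsSelfAdjoint.smul ?_ hs)
      simp [isSelfAdjoint_iff]
    obtain ⟨J, _, e, l, he, hl⟩ := ih hmem hsa' hn
    refine ⟨J × Bool, inferInstance, _,
      fun p => l p.1 + (if p.2 then ((M / 2 : ℝ) : ℂ) else -((M / 2 : ℝ) : ℂ)),
      he.mul hD (.bool hF hFp), ?_⟩
    rintro ⟨j, b⟩
    set c : ℂ := ((M / 2 : ℝ) : ℂ)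
    set f : B H := if b then F else 1 - F with hf
    have hfn : ‖f‖ ≤ 1 := by
      refine IsStarProjection.norm_le f ?_
      cases b <;> simp [hf, hFp, hFp.one_sub]
    have hfF : (2 * F - 1) * f = (if b then (1 : ℂ) else -1) • f := by
      have := hFp.isIdempotentElem.eq
      cases b
      · simp only [hf, Bool.false_eq_true, if_false, sub_mul, mul_sub, mul_assoc, this, mul_one,
          one_mul, neg_smul, one_smul]
        abel
      · simp only [hf, if_true, sub_mul, mul_assoc, this, one_mul, one_smul]
        rw [two_mul]
        abel
    have hcomm : e j * f = f * e j := hD.1 _ (he.mem j) _ ((IsProjPartition.bool hF hFp).mem b)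
    have hA2 : (A - (l j + (if b then c else -c)) • 1) * (e j * f) =
        ((A - c • (2 * F - 1) - l j • 1) * e j) * f := by
      have h1 : (c • (2 * F - 1)) * (f * e j) = (if b then c else -c) • (f * e j) := by
        rw [smul_mul_assoc, ← mul_assoc, hfF, smul_mul_assoc, smul_smul]
        cases b <;> simp
      rw [mul_assoc, hcomm, sub_mul, sub_mul, sub_mul, h1, add_smul, add_mul]
      simp only [smul_mul_assoc, one_mul]
      abel
    calc ‖(A - (l j + (if b then c else -c)) • 1) * (e j * f)‖ = _ := by rw [hA2]
      _ ≤ ‖(A - c • (2 * F - 1) - l j • 1) * e j‖ * ‖f‖ := norm_mul_le _ _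
      _ ≤ M / 2 / 2 ^ k * 1 := by
        gcongr
        · exact (norm_nonneg _).trans (hl j)
        · exact hl j
      _ = M / 2 ^ (k + 1) := by rw [pow_succ]; ring

/-- Passing to a refinement preserves approximate scalarity. -/
theorem norm_mul_mul_le_of_isStarProjection {X e f : B H} (hf : IsStarProjection f) :
    ‖X * (e * f)‖ ≤ ‖X * e‖ := by
  rw [← mul_assoc]
  calc _ ≤ ‖X * e‖ * ‖f‖ := norm_mul_le _ _
    _ ≤ ‖X * e‖ * 1 := by gcongr; exact IsStarProjection.norm_le f hf
    _ = _ := mul_one _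

theorem SchurHyper.IsMasa.exists_partition_of_mem {D : StarSubalgebra ℂ (B H)} (hD : IsMasa D)
    {b : B H} (hb : b ∈ D) {ε : ℝ} (hε : 0 < ε) :
    ∃ (J : Type) (_ : Fintype J) (e : J → B H) (l : J → ℂ), IsProjPartition D e ∧
      ∀ j, ‖(b - l j • 1) * e j‖ ≤ ε := by
  have hre : ((realPart b : selfAdjoint (B H)) : B H) ∈ D := by
    refine hD.2 _ fun A hA => ?_
    rw [realPart_apply_coe, smul_mul_assoc, mul_smul_comm, add_mul, mul_add, hD.1 _ hb _ hA,
      hD.1 _ (star_mem hb) _ hA]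
  have him : ((imaginaryPart b : selfAdjoint (B H)) : B H) ∈ D := by
    refine hD.2 _ fun A hA => ?_
    rw [imaginaryPart_apply_coe, smul_mul_assoc, mul_smul_comm, smul_mul_assoc, mul_smul_comm,
      sub_mul, mul_sub, hD.1 _ hb _ hA, hD.1 _ (star_mem hb) _ hA]
  set u := ((realPart b : selfAdjoint (B H)) : B H)
  set v := ((imaginaryPart b : selfAdjoint (B H)) : B H)
  have hbuv : b = u + Complex.I • v := (realPart_add_I_smul_imaginaryPart b).symm
  have hk : ∃ k : ℕ, ∀ M : ℝ, M ≤ ‖u‖ + ‖v‖ → M / 2 ^ k ≤ ε / 2 := by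
    obtain ⟨k, hk⟩ := pow_unbounded_of_one_lt ((‖u‖ + ‖v‖) / (ε / 2)) (one_lt_two : (1 : ℝ) < 2)
    refine ⟨k, fun M hM => ?_⟩
    rw [div_lt_iff₀ (by positivity)] at hk
    rw [div_le_iff₀ (by positivity)]
    linarith
  obtain ⟨k, hk⟩ := hk
  obtain ⟨J, _, e, l, he, hl⟩ :=
    hD.exists_partition_of_isSelfAdjoint k hre (realPart b).2 le_rfl
  obtain ⟨K, _, f, m, hf, hm⟩ :=
    hD.exists_partition_of_isSelfAdjoint k him (imaginaryPart b).2 le_rfl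
  refine ⟨J × K, inferInstance, _, fun p => l p.1 + Complex.I * m p.2, he.mul hD hf, ?_⟩
  rintro ⟨i, j⟩
  have hsplit : (b - (l i + Complex.I * m j) • 1) * (e i * f j) =
      (u - l i • 1) * (e i * f j) + Complex.I • ((v - m j • 1) * (f j * e i)) := by
    rw [hD.1 _ (hf.mem j) _ (he.mem i), hbuv]
    simp only [sub_mul, add_mul, smul_mul_assoc, one_mul, add_smul, smul_sub, smul_smul]
    abel
  calc _ = ‖(u - l i • 1) * (e i * f j) + Complex.I • ((v - m j • 1) * (f j * e i))‖ := by
        rw [← hsplit]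
    _ ≤ ‖(u - l i • 1) * (e i * f j)‖ + ‖Complex.I • ((v - m j • 1) * (f j * e i))‖ :=
        norm_add_le _ _
    _ ≤ ε / 2 + ε / 2 := by
        rw [norm_smul, Complex.norm_I, one_mul]
        refine add_le_add ?_ ?_
        · refine (norm_mul_mul_le_of_isStarProjection (hf.proj j)).trans ((hl i).trans (hk _ ?_))
          linarith [norm_nonneg v]
        · refine (norm_mul_mul_le_of_isStarProjection (he.proj i)).trans ((hm j).trans (hk _ ?_))
          linarith [norm_nonneg u]
    _ = ε := add_halves ε

/-- Finitely many elements of a masa are simultaneously nearly scalar on the pieces of a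
finite partition. -/
theorem SchurHyper.IsMasa.exists_partition {D : StarSubalgebra ℂ (B H)} (hD : IsMasa D)
    {ι : Type*} (s : Finset ι) {b : ι → B H} (hb : ∀ i ∈ s, b i ∈ D) {ε : ℝ} (hε : 0 < ε) :
    ∃ (J : Type) (_ : Fintype J) (e : J → B H) (l : ι → J → ℂ), IsProjPartition D e ∧
      ∀ i ∈ s, ∀ j, ‖(b i - l i j • 1) * e j‖ ≤ ε := by
  classical
  induction s using Finset.induction_on with
  | empty => exact ⟨Unit, inferInstance, fun _ => 1, fun _ _ => 0, .one D, by simp⟩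
  | insert a s ha ih =>
    obtain ⟨J, _, e, l, he, hl⟩ := ih fun i hi => hb i (Finset.mem_insert_of_mem hi)
    obtain ⟨K, _, f, m, hf, hm⟩ := hD.exists_partition_of_mem (hb a (Finset.mem_insert_self a s)) hε
    refine ⟨J × K, inferInstance, _, fun i p => if i = a then m p.2 else l i p.1, he.mul hD hf, ?_⟩
    rintro i hi ⟨j, k⟩
    dsimp only
    rcases Finset.mem_insert.1 hi with rfl | hi
    · rw [if_pos rfl, hD.1 _ (he.mem j) _ (hf.mem k)]
      exact (norm_mul_mul_le_of_isStarProjection (he.proj j)).trans (hm k)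
    · rw [if_neg fun h : i = a => ha (h ▸ hi)]
      exact (norm_mul_mul_le_of_isStarProjection (hf.proj k)).trans (hl i hi j)

/-- The `ℓ²`-direct sum of copies of `H`. -/
abbrev HilbertPower (ι : Type*) (H : Type*) [NormedAddCommGroup H] : Type _ :=
  lp (fun _ : ι => H) 2

section Amplification

variable {ι E : Type*} [NormedAddCommGroup E]

theorem hasSum_norm_sq_hilbertPower (f : HilbertPower ι E) :
    HasSum (fun i => ‖f i‖ ^ 2) (‖f‖ ^ 2) := by
  have := lp.hasSum_norm (p := 2) (by norm_num) f
  simpa using this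

theorem memℓp_two_iff_summable_sq {f : ι → E} :
    Memℓp f 2 ↔ Summable fun i => ‖f i‖ ^ 2 := by
  rw [memℓp_gen_iff (by norm_num)]
  simp

variable [InnerProductSpace ℂ E]

/-- The amplification of an operator on `E`, acting on every copy of `E`. -/
def amplification (A : B E) : HilbertPower ι E →L[ℂ] HilbertPower ι E :=
  have bound (f : HilbertPower ι E) (i : ι) : ‖A (f i)‖ ^ 2 ≤ ‖A‖ ^ 2 * ‖f i‖ ^ 2 := by
    rw [← mul_pow]
    gcongr
    exact A.le_opNorm _
  have mem (f : HilbertPower ι E) : Memℓp (fun i => A (f i)) 2 :=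
    memℓp_two_iff_summable_sq.2 <| .of_nonneg_of_le (fun _ => by positivity) (bound f)
      ((hasSum_norm_sq_hilbertPower f).summable.mul_left _)
  LinearMap.mkContinuous
    { toFun := fun f => ⟨fun i => A (f i), mem f⟩
      map_add' := fun f g => by ext i; exact map_add A (f i) (g i)
      map_smul' := fun c f => by ext i; exact map_smul A c (f i) }
    ‖A‖ fun f => by
      refine le_of_sq_le_sq ?_ (by positivity)
      rw [mul_pow, ← (hasSum_norm_sq_hilbertPower _).tsum_eq,
        ← (hasSum_norm_sq_hilbertPower f).tsum_eq, ← tsum_mul_left]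
      exact Summable.tsum_le_tsum (bound f) (hasSum_norm_sq_hilbertPower _).summable
        ((hasSum_norm_sq_hilbertPower f).summable.mul_left _)

@[simp]
theorem amplification_apply (A : B E) (f : HilbertPower ι E) (i : ι) :
    amplification A f i = A (f i) := rfl

theorem norm_amplification_le (A : B E) :
    ‖(amplification A : HilbertPower ι E →L[ℂ] HilbertPower ι E)‖ ≤ ‖A‖ := by
  unfold amplification
  exact LinearMap.mkContinuous_norm_le _ (norm_nonneg _) _

theorem amplification_mul_apply (A C : B E) (f : HilbertPower ι E) :
    amplification (A * C) f = amplification A (amplification C f) := by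
  ext i
  rfl

variable [CompleteSpace E]

theorem inner_amplification_star_left (A : B E) (f g : HilbertPower ι E) :
    ⟪amplification (star A) f, g⟫_ℂ = ⟪f, amplification A g⟫_ℂ := by
  rw [lp.inner_eq_tsum, lp.inner_eq_tsum]
  congr 1
  ext i
  exact ContinuousLinearMap.adjoint_inner_left A _ _

theorem star_amplification (A : B E) :
    star (amplification A : B (HilbertPower ι E)) = amplification (star A) := by
  refine ((ContinuousLinearMap.eq_adjoint_iff _ _).2 fun f g => ?_).symm
  exact inner_amplification_star_left A f g

end Amplification

/-- The closed cyclic subspace generated by a vector under an algebra of operators. -/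
def cyclicSubspace (D : StarSubalgebra ℂ (B H)) (ξ : H) : Submodule ℂ H :=
  (D.toSubalgebra.toSubmodule.map (ContinuousLinearMap.apply ℂ H ξ).toLinearMap).topologicalClosure

theorem apply_mem_cyclicSubspace {D : StarSubalgebra ℂ (B H)} {A : B H} (hA : A ∈ D) (ξ : H) :
    A ξ ∈ cyclicSubspace D ξ :=
  subset_closure ⟨A, hA, rfl⟩

theorem self_mem_cyclicSubspace (D : StarSubalgebra ℂ (B H)) (ξ : H) : ξ ∈ cyclicSubspace D ξ :=
  apply_mem_cyclicSubspace (one_mem D) ξ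

theorem isClosed_cyclicSubspace (D : StarSubalgebra ℂ (B H)) (ξ : H) :
    IsClosed (cyclicSubspace D ξ : Set H) := Submodule.isClosed_topologicalClosure _

theorem cyclicSubspace_invariant {D : StarSubalgebra ℂ (B H)} {ξ : H} {A : B H} (hA : A ∈ D)
    {v : H} (hv : v ∈ cyclicSubspace D ξ) : A v ∈ cyclicSubspace D ξ := by
  refine map_mem_closure A.continuous hv ?_
  rintro _ ⟨C, hC, rfl⟩
  exact ⟨A * C, (show A * C ∈ D from mul_mem hA hC), rfl⟩

theorem norm_apply_eq_norm_star_apply {A : B H} (hA : star A * A = A * star A) (v : H) :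
    ‖A v‖ = ‖star A v‖ :=
  ((ContinuousLinearMap.isStarNormal_iff_norm_eq_adjoint).1 ⟨hA⟩ v)

/-- For a family `Ξ` of vectors in the cyclic subspace of `Ξ i₀`, the compression to the `i₀`-th
copy of `H` of the projection onto the cyclic subspace of `Ξ` (under the amplification of `D`). -/
theorem SchurHyper.IsMasa.exists_graph_operator {D : StarSubalgebra ℂ (B H)} (hD : IsMasa D)
    {ι : Type*} (Ξ : HilbertPower ι H) (i₀ : ι) (hΞ : ∀ i, Ξ i ∈ cyclicSubspace D (Ξ i₀)) :
    ∃ V : H →L[ℂ] HilbertPower ι H,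
      (∀ i, (lp.evalCLM ℂ (fun _ : ι => H) 2 i).comp V ∈ D) ∧
      (∀ v, ⟪v, V v i₀⟫_ℂ = (‖V v‖ : ℂ) ^ 2) ∧
      (∀ i, V (Ξ i) i₀ = V (Ξ i₀) i) ∧
      (∀ v, ‖⟪v, Ξ i₀⟫_ℂ‖ ≤ ‖V v‖ * ‖Ξ‖) := by
  classical
  set S : Set (HilbertPower ι H) := (fun A : B H => amplification A Ξ) '' (D : Set (B H)) with hS
  let amp : B H →ₗ[ℂ] HilbertPower ι H :=
    { toFun := fun A => amplification A Ξ
      map_add' := fun A C => by ext i; rfl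
      map_smul' := fun c A => by ext i; rfl }
  set M : Submodule ℂ (HilbertPower ι H) :=
    (D.toSubalgebra.toSubmodule.map amp).topologicalClosure with hM
  have hclosed : IsClosed (M : Set (HilbertPower ι H)) := Submodule.isClosed_topologicalClosure _
  have hMS : (M : Set (HilbertPower ι H)) = closure S := rfl
  have : CompleteSpace M := hclosed.completeSpace_coe
  have hinv : ∀ A ∈ D, ∀ f ∈ M, (amplification A : B (HilbertPower ι H)) f ∈ M := by
    intro A hA f hf
    refine map_mem_closure (amplification A).continuous hf ?_
    rintro _ ⟨C, hC, rfl⟩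
    exact ⟨A * C, (show A * C ∈ D from mul_mem hA hC), amplification_mul_apply A C Ξ⟩
  set P := M.starProjection with hP
  have hcomm : ∀ A ∈ D, ∀ f, P (amplification A f) = amplification A (P f) := by
    intro A hA f
    have := starProjection_commute_of_reducing (hinv A hA) (K := M) fun f hf => by
      rw [star_amplification]
      exact hinv _ (star_mem hA) f hf
    exact congrArg (fun T : B (HilbertPower ι H) => T f) this
  set V : H →L[ℂ] HilbertPower ι H :=
    P.comp (lp.singleContinuousLinearMap ℂ (fun _ : ι => H) 2 i₀) with hV
  have hVapp : ∀ v, V v = P (lp.single 2 i₀ v) := fun v => rfl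
  have hsingle : ∀ (A : B H) v, lp.single (E := fun _ : ι => H) 2 i₀ (A v) =
      amplification A (lp.single 2 i₀ v) := by
    intro A v
    ext i
    rw [amplification_apply]
    by_cases h : i = i₀
    · subst h; simp
    · rw [lp.single_apply_ne _ _ _ h, lp.single_apply_ne _ _ _ h, map_zero]
  have hVmem : ∀ i, (lp.evalCLM ℂ (fun _ : ι => H) 2 i).comp V ∈ D := by
    intro i
    refine hD.2 _ fun A hA => ?_
    ext v
    change V (A v) i = A (V v i)
    rw [hVapp, hsingle, hcomm A hA, hVapp, amplification_apply]
  have hinner : ∀ v, ⟪v, V v i₀⟫_ℂ = (‖V v‖ : ℂ) ^ 2 := by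
    intro v
    have hs : ⟪v, V v i₀⟫_ℂ = ⟪lp.single (E := fun _ : ι => H) 2 i₀ v, V v⟫_ℂ :=
      (lp.inner_single_left i₀ v (V v)).symm
    refine hs.trans (Eq.trans ?_ (inner_self_eq_norm_sq_to_K (𝕜 := ℂ) (V v)))
    rw [hVapp, Submodule.inner_starProjection_left_eq_right, ← mul_apply_eq_comp,
      (Submodule.isIdempotentElem_starProjection M).eq]
  have hΞM : Ξ ∈ M := subset_closure ⟨1, one_mem D, by ext i; rfl⟩
  refine ⟨V, hVmem, hinner, fun i => ?_, fun v => ?_⟩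
  · set a : B H := (lp.evalCLM ℂ (fun _ : ι => H) 2 i₀).comp V with ha
    set b : B H := (lp.evalCLM ℂ (fun _ : ι => H) 2 i).comp V with hb
    set ξ := Ξ i₀ with hξ
    have hasa : ∀ u w, ⟪a u, w⟫_ℂ = ⟪u, a w⟫_ℂ := by
      intro u w
      have h1 : ⟪a u, w⟫_ℂ = ⟪V u, lp.single (E := fun _ : ι => H) 2 i₀ w⟫_ℂ :=
        (lp.inner_single_right i₀ w (V u)).symm
      have h2 : ⟪u, a w⟫_ℂ = ⟪lp.single (E := fun _ : ι => H) 2 i₀ u, V w⟫_ℂ :=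
        (lp.inner_single_left i₀ u (V w)).symm
      rw [h1, h2, hVapp, hVapp, Submodule.inner_starProjection_left_eq_right]
    have hVM : V ξ ∈ closure S := M.starProjection_apply_mem _
    obtain ⟨g, hgS, hg⟩ := mem_closure_iff_seq_limit.1 hVM
    choose c hcD hc using hgS
    have hlim : ∀ j, Filter.Tendsto (fun k => c k (Ξ j)) Filter.atTop (nhds (V ξ j)) := by
      intro j
      have := ((lp.evalCLM ℂ (fun _ : ι => H) 2 j).continuous.tendsto (V ξ)).comp hg
      refine this.congr fun k => ?_
      simp only [Function.comp, ← hc]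
      rfl
    have haD : a ∈ D := hVmem i₀
    have hbD : b ∈ D := hVmem i
    have hasa' : star a = a := by
      refine ((ContinuousLinearMap.eq_adjoint_iff _ _).2 fun f g => hasa f g).symm
    have hstar : Filter.Tendsto (fun k => star (c k) ξ) Filter.atTop (nhds (a ξ)) := by
      rw [tendsto_iff_norm_sub_tendsto_zero]
      have h0 := tendsto_iff_norm_sub_tendsto_zero.1 (hlim i₀)
      refine h0.congr fun k => ?_
      have hcD' := sub_mem (hcD k) haD
      have := norm_apply_eq_norm_star_apply (hD.1 _ (star_mem hcD') _ hcD') ξ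
      rw [star_sub, hasa'] at this
      exact this
    have hmem : a (Ξ i) - b ξ ∈ cyclicSubspace D ξ :=
      sub_mem (cyclicSubspace_invariant haD (hΞ i)) (apply_mem_cyclicSubspace hbD ξ)
    have horth : ∀ d ∈ D, ⟪d ξ, a (Ξ i) - b ξ⟫_ℂ = 0 := by
      intro d hd
      rw [inner_sub_right, sub_eq_zero]
      have h1 : Filter.Tendsto (fun k => ⟪d (star (c k) ξ), Ξ i⟫_ℂ) Filter.atTop
          (nhds ⟪d (a ξ), Ξ i⟫_ℂ) :=
        (((d.continuous.tendsto _).comp hstar).inner tendsto_const_nhds)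
      have h2 : Filter.Tendsto (fun k => ⟪d ξ, c k (Ξ i)⟫_ℂ) Filter.atTop
          (nhds ⟪d ξ, b ξ⟫_ℂ) :=
        tendsto_const_nhds.inner (hlim i)
      have h3 : ∀ k, ⟪d (star (c k) ξ), Ξ i⟫_ℂ = ⟪d ξ, c k (Ξ i)⟫_ℂ := by
        intro k
        have := congrArg (fun T : B H => T ξ) (hD.1 _ hd _ (star_mem (hcD k)))
        change d (star (c k) ξ) = star (c k) (d ξ) at this
        rw [this]
        exact ContinuousLinearMap.adjoint_inner_left _ _ _
      have h4 := tendsto_nhds_unique (h1.congr h3) h2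
      rw [← h4, ← hasa]
      congr 1
      exact congrArg (fun T : B H => T ξ) (hD.1 _ haD _ hd)
    have hzero : a (Ξ i) - b ξ = 0 := by
      rw [← inner_self_eq_zero (𝕜 := ℂ)]
      refine closure_minimal (s := (fun A : B H => A ξ) '' (D : Set (B H)))
        (t := {u | ⟪u, a (Ξ i) - b ξ⟫_ℂ = 0}) ?_ ?_ hmem
      · rintro _ ⟨d, hd, rfl⟩
        exact horth d hd
      · exact isClosed_eq (by fun_prop) continuous_const
    exact sub_eq_zero.1 hzero
  · have : ⟪v, Ξ i₀⟫_ℂ = ⟪V v, Ξ⟫_ℂ := by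
      rw [hVapp, Submodule.inner_starProjection_left_eq_right,
        Submodule.starProjection_eq_self_iff.2 hΞM, lp.inner_single_left]
    rw [this]
    exact norm_inner_le_norm _ _

section VectorFunctional

variable {E : Type*} [NormedAddCommGroup E]

/-- The concatenation of two square-summable families. -/
def HilbertPower.sumElim {ι κ : Type*} (f : HilbertPower ι E) (g : HilbertPower κ E) :
    HilbertPower (ι ⊕ κ) E :=
  ⟨Sum.elim f g, memℓp_two_iff_summable_sq.2 <| by
    have h : HasSum (fun i => ‖(Sum.elim f g : ι ⊕ κ → E) i‖ ^ 2) (‖f‖ ^ 2 + ‖g‖ ^ 2) :=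
      HasSum.sum (hasSum_norm_sq_hilbertPower f) (hasSum_norm_sq_hilbertPower g)
    exact h.summable⟩

@[simp]
theorem HilbertPower.sumElim_inl {ι κ : Type*} (f : HilbertPower ι E) (g : HilbertPower κ E)
    (i : ι) : HilbertPower.sumElim f g (Sum.inl i) = f i := rfl

@[simp]
theorem HilbertPower.sumElim_inr {ι κ : Type*} (f : HilbertPower ι E) (g : HilbertPower κ E)
    (i : κ) : HilbertPower.sumElim f g (Sum.inr i) = g i := rfl

variable [InnerProductSpace ℂ E]

theorem HilbertPower.inner_sumElim_amplification {ι κ : Type*} (y x : HilbertPower ι E)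
    (y' x' : HilbertPower κ E) (T : B E) :
    ⟪sumElim y y', amplification T (sumElim x x')⟫_ℂ =
      ⟪y, amplification T x⟫_ℂ + ⟪y', amplification T x'⟫_ℂ := by
  refine (lp.hasSum_inner _ _).unique (HasSum.sum ?_ ?_)
  · exact lp.hasSum_inner y (amplification T x)
  · exact lp.hasSum_inner y' (amplification T x')

/-- Functionals of the form `T ↦ ∑ᵢ ⟪yᵢ, T xᵢ⟫` for some square-summable families. -/
def IsVectorFunctional (ω : B E →ₗ[ℂ] ℂ) : Prop :=
  ∃ (ι : Type) (x y : HilbertPower ι E), ∀ T : B E, ω T = ⟪y, amplification T x⟫_ℂ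

theorem SchurHyper.IsNormalFunctional.isVectorFunctional {ω : B E →ₗ[ℂ] ℂ}
    (h : IsNormalFunctional E ω) : IsVectorFunctional ω := by
  obtain ⟨x, y, hx, hy, h⟩ := h
  refine ⟨ℕ, ⟨x, memℓp_two_iff_summable_sq.2 hx⟩, ⟨y, memℓp_two_iff_summable_sq.2 hy⟩, fun T => ?_⟩
  rw [h, lp.inner_eq_tsum]
  rfl

theorem isVectorFunctional_of_mem_span {ω : B E →ₗ[ℂ] ℂ}
    (h : ω ∈ Submodule.span ℂ {ω : B E →ₗ[ℂ] ℂ | IsNormalFunctional E ω}) :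
    IsVectorFunctional ω := by
  induction h using Submodule.span_induction with
  | mem ω h => exact h.isVectorFunctional
  | zero => exact ⟨Unit, 0, 0, by simp⟩
  | add ω ω' _ _ h h' =>
    obtain ⟨ι, x, y, h⟩ := h
    obtain ⟨κ, x', y', h'⟩ := h'
    refine ⟨ι ⊕ κ, .sumElim x x', .sumElim y y', fun T => ?_⟩
    rw [HilbertPower.inner_sumElim_amplification, LinearMap.add_apply, h, h']
  | smul c ω _ h =>
    obtain ⟨ι, x, y, h⟩ := h
    refine ⟨ι, c • x, y, fun T => ?_⟩
    rw [map_smul, inner_smul_right, LinearMap.smul_apply, h, smul_eq_mul]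

theorem isVectorFunctional_of_continuous {ω : B E →ₗ[ℂ] ℂ}
    (h : @Continuous _ _ (weakStarTopology E) _ ω) : IsVectorFunctional ω := by
  apply isVectorFunctional_of_mem_span
  have := (LinearMap.mem_span_iff_continuous
    (f := fun ω : {ω : B E →ₗ[ℂ] ℂ // IsNormalFunctional E ω} => ω.1) ω).2 ?_
  · simpa using this
  · rwa [← induced_to_pi]

/-- A vector state composed with a weak* continuous map. -/
theorem SchurHyper.WStarContinuous.isVectorFunctional {Φ : B E →L[ℂ] B E}
    (hΦ : WStarContinuous E Φ) (η ξ : E) :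
    ∃ (ι : Type) (x y : HilbertPower ι E), ∀ T : B E,
      ⟪η, Φ T ξ⟫_ℂ = ⟪y, amplification T x⟫_ℂ := by
  classical
  let ω₀ : B E →ₗ[ℂ] ℂ :=
    (innerSL ℂ η).toLinearMap ∘ₗ (ContinuousLinearMap.apply ℂ E ξ).toLinearMap
  have hω₀ : IsNormalFunctional E ω₀ := by
    refine ⟨fun n => if n = 0 then ξ else 0, fun n => if n = 0 then η else 0, ?_, ?_, fun T => ?_⟩
    · exact summable_of_ne_finset_zero (s := {0}) (by simp +contextual)
    · exact summable_of_ne_finset_zero (s := {0}) (by simp +contextual)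
    · rw [tsum_eq_single 0 (by simp +contextual)]
      rfl
  refine isVectorFunctional_of_continuous (ω := ω₀ ∘ₗ Φ.toLinearMap) ?_
  have h1 : @Continuous _ _ (weakStarTopology E) _ ω₀ :=
    @Continuous.comp _ _ _ (weakStarTopology E) _ _
      (fun (T : B E) (ω : {ω : B E →ₗ[ℂ] ℂ // IsNormalFunctional E ω}) => ω.1 T)
      (fun u => u ⟨ω₀, hω₀⟩) (continuous_apply _) continuous_induced_dom
  exact @Continuous.comp _ _ _ (weakStarTopology E) (weakStarTopology E) _ Φ ω₀ h1 hΦ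

end VectorFunctional

/-- The projection onto a cyclic subspace of a masa belongs to the masa. -/
theorem SchurHyper.IsMasa.exists_cyclic_projection {D : StarSubalgebra ℂ (B H)} (hD : IsMasa D)
    (ξ : H) : ∃ q ∈ D, IsStarProjection q ∧ q ξ = ξ ∧ ∀ v, q v ∈ cyclicSubspace D ξ := by
  have : CompleteSpace (cyclicSubspace D ξ) := (isClosed_cyclicSubspace D ξ).completeSpace_coe
  exact ⟨(cyclicSubspace D ξ).starProjection,
    hD.starProjection_mem fun A hA v hv => cyclicSubspace_invariant hA hv,
    isStarProjection_starProjection,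
    Submodule.starProjection_eq_self_iff.2 (self_mem_cyclicSubspace D ξ),
    fun v => Submodule.starProjection_apply_mem _ v⟩

theorem IsSelfAdjoint.inner_apply_left {A : B H} (hA : IsSelfAdjoint A) (u v : H) :
    ⟪A u, v⟫_ℂ = ⟪u, A v⟫_ℂ := by
  rw [← ContinuousLinearMap.adjoint_inner_right]
  exact congrArg (fun T : B H => ⟪u, T v⟫_ℂ) hA

/-- The vector functional of `Φ + id` is implemented by families supported in the cyclic
subspaces of the two vectors, and containing these vectors. -/
theorem SchurHyper.IsSchurMultiplier.exists_representation {D : StarSubalgebra ℂ (B H)}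
    (hD : IsMasa D) {Φ : B H →L[ℂ] B H} (hΦ : IsSchurMultiplier D Φ) (η ξ : H) :
    ∃ (ι : Type) (i₀ : ι) (Ξ Y : HilbertPower ι H), Ξ i₀ = ξ ∧ Y i₀ = η ∧
      (∀ i, Ξ i ∈ cyclicSubspace D ξ) ∧ (∀ i, Y i ∈ cyclicSubspace D η) ∧
      ∀ T : B H, ⟪η, (Φ T + T) ξ⟫_ℂ = ⟪Y, amplification T Ξ⟫_ℂ := by
  obtain ⟨ι, x, y, h⟩ := hΦ.1.isVectorFunctional η ξ
  obtain ⟨q, hqD, hqp, hq, hqm⟩ := hD.exists_cyclic_projection ξ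
  obtain ⟨p, hpD, hpp, hp, hpm⟩ := hD.exists_cyclic_projection η
  refine ⟨ι ⊕ Unit, Sum.inr (), .sumElim (amplification q x) (lp.single 2 () ξ),
    .sumElim (amplification p y) (lp.single 2 () η), by simp, by simp, ?_, ?_, fun T => ?_⟩
  · rintro (i | i)
    · exact hqm _
    · simpa using self_mem_cyclicSubspace D ξ
  · rintro (i | i)
    · exact hpm _
    · simpa using self_mem_cyclicSubspace D η
  · rw [HilbertPower.inner_sumElim_amplification, lp.inner_single_left, amplification_apply,
      lp.single_apply_self, add_apply, inner_add_right]
    congr 1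
    have h1 : ⟪η, Φ T ξ⟫_ℂ = ⟪η, Φ (p * T * q) ξ⟫_ℂ := by
      rw [hΦ.2 p hpD q hqD, mul_apply_eq_comp, mul_apply_eq_comp, hq,
        ← hpp.isSelfAdjoint.inner_apply_left, hp]
    rw [h1, h, amplification_mul_apply, amplification_mul_apply,
      ← inner_amplification_star_left, hpp.isSelfAdjoint.star_eq]

/-- The operators `V` produced by `IsMasa.exists_graph_operator`. -/
structure IsGraphOperator (D : StarSubalgebra ℂ (B H)) {ι : Type} (Ξ : HilbertPower ι H) (i₀ : ι)
    (V : H →L[ℂ] HilbertPower ι H) : Prop where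
  entry_mem : ∀ i, (lp.evalCLM ℂ (fun _ : ι => H) 2 i).comp V ∈ D
  inner_entry : ∀ v, ⟪v, V v i₀⟫_ℂ = (‖V v‖ : ℂ) ^ 2
  symm_apply : ∀ i, V (Ξ i) i₀ = V (Ξ i₀) i
  norm_inner_le : ∀ v, ‖⟪v, Ξ i₀⟫_ℂ‖ ≤ ‖V v‖ * ‖Ξ‖

namespace IsGraphOperator

variable {D : StarSubalgebra ℂ (B H)} {ι : Type} {Ξ : HilbertPower ι H} {i₀ : ι}
  {V : H →L[ℂ] HilbertPower ι H}

theorem apply_apply (hD : IsMasa D) (hV : IsGraphOperator D Ξ i₀ V) {A : B H} (hA : A ∈ D)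
    (v : H) : V (A v) = amplification A (V v) := by
  ext i
  exact congrArg (fun T : B H => T v) (hD.1 _ (hV.entry_mem i) _ hA)

theorem apply_generator (hD : IsMasa D) (hV : IsGraphOperator D Ξ i₀ V) {A : B H} (hA : A ∈ D) :
    V (A (Ξ i₀)) =
      amplification (A * (lp.evalCLM ℂ (fun _ : ι => H) 2 i₀).comp V) Ξ := by
  rw [hV.apply_apply hD hA]
  ext i
  exact congrArg A (hV.symm_apply i).symm

theorem norm_apply_le (hV : IsGraphOperator D Ξ i₀ V) (v : H) : ‖V v‖ ≤ ‖v‖ := by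
  have h1 : ‖V v‖ ^ 2 ≤ ‖v‖ * ‖V v‖ := by
    have h2 : ‖⟪v, V v i₀⟫_ℂ‖ = ‖V v‖ ^ 2 := by
      rw [hV.inner_entry]
      simp
    rw [← h2]
    refine (norm_inner_le_norm _ _).trans ?_
    gcongr
    exact lp.norm_apply_le_norm (by norm_num) (V v) i₀
  nlinarith [norm_nonneg (V v), norm_nonneg v]

theorem norm_sq_apply_le (hV : IsGraphOperator D Ξ i₀ V) (v : H) :
    ‖V v‖ ^ 2 ≤ ‖v‖ * ‖V v i₀‖ := by
  have h2 : ‖⟪v, V v i₀⟫_ℂ‖ = ‖V v‖ ^ 2 := by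
    rw [hV.inner_entry]
    simp
  rw [← h2]
  exact norm_inner_le_norm _ _

theorem isSelfAdjoint_entry (hV : IsGraphOperator D Ξ i₀ V) :
    IsSelfAdjoint ((lp.evalCLM ℂ (fun _ : ι => H) 2 i₀).comp V) := by
  rw [ContinuousLinearMap.isSelfAdjoint_iff_isSymmetric,
    LinearMap.isSymmetric_iff_inner_map_self_real]
  intro v
  rw [inner_conj_symm]
  have h : ⟪v, V v i₀⟫_ℂ = (‖V v‖ : ℂ) ^ 2 := hV.inner_entry v
  have h' : ⟪V v i₀, v⟫_ℂ = (‖V v‖ : ℂ) ^ 2 := by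
    rw [← inner_conj_symm, h]
    simp
  exact h.trans h'.symm

end IsGraphOperator

/-- The vector functional identity for `Φ + id`, transported by graph operators. -/
theorem SchurHyper.IsSchurMultiplier.inner_graphOperator {D : StarSubalgebra ℂ (B H)}
    (hD : IsMasa D) {Φ : B H →L[ℂ] B H} (hΦ : IsSchurMultiplier D Φ)
    {ι : Type} {i₀ : ι} {Ξ Y : HilbertPower ι H} {V W : H →L[ℂ] HilbertPower ι H}
    (hV : IsGraphOperator D Ξ i₀ V) (hW : IsGraphOperator D Y i₀ W)
    (h : ∀ T : B H, ⟪Y i₀, (Φ T + T) (Ξ i₀)⟫_ℂ = ⟪Y, amplification T Ξ⟫_ℂ)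
    (T : B H) {v w : H} (hv : v ∈ cyclicSubspace D (Ξ i₀)) (hw : w ∈ cyclicSubspace D (Y i₀)) :
    ⟪W w i₀, (Φ T + T) (V v i₀)⟫_ℂ = ⟪W w, amplification T (V v)⟫_ℂ := by
  have hcV : Continuous fun v => V v i₀ :=
    ((lp.evalCLM ℂ (fun _ : ι => H) 2 i₀).comp V).continuous
  have hcW : Continuous fun w => W w i₀ :=
    ((lp.evalCLM ℂ (fun _ : ι => H) 2 i₀).comp W).continuous
  refine closure_minimal (s := (fun A : B H => A (Ξ i₀)) '' (D : Set (B H)))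
    (t := {v | ⟪W w i₀, (Φ T + T) (V v i₀)⟫_ℂ = ⟪W w, amplification T (V v)⟫_ℂ}) ?_ ?_ hv
  swap
  · exact isClosed_eq (continuous_const.inner ((Φ T + T).continuous.comp hcV)) (by fun_prop)
  rintro _ ⟨c, hc, rfl⟩
  refine closure_minimal (s := (fun A : B H => A (Y i₀)) '' (D : Set (B H)))
    (t := {w | ⟪W w i₀, (Φ T + T) (V (c (Ξ i₀)) i₀)⟫_ℂ =
      ⟪W w, amplification T (V (c (Ξ i₀)))⟫_ℂ}) ?_ ?_ hw
  swap
  · exact isClosed_eq (hcW.inner continuous_const) (by fun_prop)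
  rintro _ ⟨d, hd, rfl⟩
  change ⟪W (d (Y i₀)) i₀, (Φ T + T) (V (c (Ξ i₀)) i₀)⟫_ℂ =
    ⟪W (d (Y i₀)), amplification T (V (c (Ξ i₀)))⟫_ℂ
  rw [hV.apply_generator hD hc, hW.apply_generator hD hd]
  set a := c * (lp.evalCLM ℂ (fun _ : ι => H) 2 i₀).comp V with ha
  set a' := d * (lp.evalCLM ℂ (fun _ : ι => H) 2 i₀).comp W with ha'
  have haD : a ∈ D := mul_mem hc (hV.entry_mem i₀)
  have haD' : a' ∈ D := mul_mem hd (hW.entry_mem i₀)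
  rw [amplification_apply, amplification_apply]
  have h1 := h (star a' * T * a)
  rw [hΦ.2 _ (star_mem haD') _ haD, ← add_mul, ← mul_add, amplification_mul_apply,
    amplification_mul_apply, ← inner_amplification_star_left, star_star] at h1
  rw [← h1]
  exact (ContinuousLinearMap.adjoint_inner_right a' _ _).symm

/-- The square of the norm of the part of a family lying outside a finite set of indices. -/
def tailSq {ι E : Type*} [NormedAddCommGroup E] (s : Finset ι) (f : HilbertPower ι E) : ℝ :=
  ‖f‖ ^ 2 - ∑ i ∈ s, ‖f i‖ ^ 2

theorem tailSq_amplification_le {ι E : Type*} [NormedAddCommGroup E] [InnerProductSpace ℂ E]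
    (s : Finset ι) {A : B E} (hA : ‖A‖ ≤ 1) (f : HilbertPower ι E) :
    tailSq s (amplification A f) ≤ tailSq s f := by
  have h := sum_le_hasSum s (fun i _ => ?_)
    ((hasSum_norm_sq_hilbertPower f).sub (hasSum_norm_sq_hilbertPower (amplification A f)))
  · rw [Finset.sum_sub_distrib] at h
    unfold tailSq
    linarith
  · rw [amplification_apply, sub_nonneg]
    gcongr
    exact A.le_of_opNorm_le hA _ |>.trans_eq (one_mul _)

theorem exists_tailSq_le {ι E : Type*} [NormedAddCommGroup E] (f : HilbertPower ι E) {ε : ℝ}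
    (hε : 0 < ε) : ∃ s₀ : Finset ι, ∀ s, s₀ ⊆ s → tailSq s f ≤ ε := by
  have h : Filter.Tendsto (fun s => ∑ i ∈ s, ‖f i‖ ^ 2) Filter.atTop (nhds (‖f‖ ^ 2)) :=
    hasSum_norm_sq_hilbertPower f
  obtain ⟨s₀, hs⟩ := Filter.eventually_atTop.1
    (h.eventually (lt_mem_nhds (sub_lt_self (‖f‖ ^ 2) hε)))
  exact ⟨s₀, fun s h => by have := hs s h; unfold tailSq; linarith⟩

theorem IsStarProjection.inner_apply_self {P : B H} (hP : IsStarProjection P) (v : H) :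
    ⟪P v, v⟫_ℂ = (‖P v‖ : ℂ) ^ 2 := by
  have h : ⟪P v, v⟫_ℂ = ⟪P v, P v⟫_ℂ := by
    rw [← hP.isSelfAdjoint.inner_apply_left, ← mul_apply_eq_comp, hP.isIdempotentElem.eq]
  rw [h]
  exact inner_self_eq_norm_sq_to_K (𝕜 := ℂ) (P v)

theorem IsStarProjection.norm_apply_le {P : B H} (hP : IsStarProjection P) (v : H) :
    ‖P v‖ ≤ ‖v‖ :=
  (P.le_of_opNorm_le (IsStarProjection.norm_le P hP) v).trans_eq (one_mul _)

/-- Cutting the generator of a cyclic subspace into finitely many pieces on which the graph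
operator is nearly given by scalars. -/
theorem IsGraphOperator.exists_pieces {D : StarSubalgebra ℂ (B H)} (hD : IsMasa D) {ι : Type}
    {Ξ : HilbertPower ι H} {i₀ : ι} {V : H →L[ℂ] HilbertPower ι H}
    (hV : IsGraphOperator D Ξ i₀ V) {ε : ℝ} (hε : 0 < ε) :
    ∃ δ > 0, ∀ τ > 0, ∃ s₀ : Finset ι, ∀ s, s₀ ⊆ s → ∀ ε' > 0,
      ∃ (J : Type) (_ : Fintype J) (q : J → B H) (l : ι → J → ℂ), IsProjFamily D q ∧
        ‖Ξ i₀ - (∑ j, q j) (Ξ i₀)‖ ≤ ε ∧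
        ∀ j v, q j v = v → v ∈ cyclicSubspace D (Ξ i₀) ∧ δ * ‖v‖ ^ 2 ≤ ‖V v‖ ^ 2 ∧
          tailSq s (V v) ≤ τ * ‖v‖ ^ 2 ∧ ∀ i ∈ s, ‖V v i - l i j • v‖ ≤ ε' * ‖v‖ := by
  set ξ := Ξ i₀ with hξ
  set b : ι → B H := fun i => (lp.evalCLM ℂ (fun _ : ι => H) 2 i).comp V with hb
  have hbD : ∀ i, b i ∈ D := hV.entry_mem
  set ρ : ℝ := ε / (2 * (‖Ξ‖ + 1)) with hρ
  have hρ0 : 0 < ρ := by positivity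
  have hρΞ : ρ * ‖Ξ‖ ≤ ε / 2 := by
    rw [hρ, div_mul_eq_mul_div, div_le_div_iff₀ (by positivity) (by positivity)]
    nlinarith [norm_nonneg Ξ]
  obtain ⟨e, heD, hep, he1, he0⟩ := hD.exists_form_cut (hbD i₀) hV.isSelfAdjoint_entry (ρ ^ 2)
  have hform : ∀ v, (⟪v, b i₀ v⟫_ℂ).re = ‖V v‖ ^ 2 := by
    intro v
    have : ⟪v, b i₀ v⟫_ℂ = (‖V v‖ : ℂ) ^ 2 := hV.inner_entry v
    rw [this, ← Complex.ofReal_pow, Complex.ofReal_re]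
  have heξ : ‖(1 - e) ξ‖ ≤ ε / 2 := by
    set z := (1 - e) ξ with hz
    have hez : e z = 0 := by
      rw [hz, ← mul_apply_eq_comp, hep.mul_one_sub_self]
      rfl
    have h1 : ‖V z‖ ^ 2 ≤ (ρ * ‖z‖) ^ 2 := by
      rw [mul_pow, ← hform]
      exact he0 z hez
    have h2 := le_of_sq_le_sq h1 (by positivity)
    have h3 := hV.norm_inner_le z
    have h4 : ⟪z, Ξ i₀⟫_ℂ = (‖z‖ : ℂ) ^ 2 := hep.one_sub.inner_apply_self ξ
    rw [h4, norm_pow, Complex.norm_real, norm_norm] at h3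
    have h5 : ‖z‖ ^ 2 ≤ (ε / 2) * ‖z‖ := by
      calc ‖z‖ ^ 2 ≤ ‖V z‖ * ‖Ξ‖ := h3
        _ ≤ ρ * ‖z‖ * ‖Ξ‖ := by gcongr
        _ = ρ * ‖Ξ‖ * ‖z‖ := by ring
        _ ≤ _ := by gcongr
    by_contra! hlt
    nlinarith [norm_nonneg z]
  refine ⟨ρ ^ 2, by positivity, fun τ hτ => ?_⟩
  obtain ⟨s₀, hs₀⟩ := exists_tailSq_le (V ξ) (ε := τ * (ε / 2) ^ 2) (by positivity)
  refine ⟨s₀, fun s hs ε' hε' => ?_⟩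
  set r : B H := b i₀ - ∑ i ∈ s, star (b i) * b i with hr
  have hrD : r ∈ D := sub_mem (hbD i₀) (sum_mem fun i _ => mul_mem (star_mem (hbD i)) (hbD i))
  have hrsa : IsSelfAdjoint r :=
    hV.isSelfAdjoint_entry.sub (isSelfAdjoint_sum _ fun i _ => IsSelfAdjoint.star_mul_self (b i))
  have hrform : ∀ v, (⟪v, r v⟫_ℂ).re = tailSq s (V v) := by
    intro v
    rw [hr, sub_apply, inner_sub_right, Complex.sub_re, hform, sum_apply, inner_sum,
      Complex.re_sum, tailSq]
    congr 1
    refine Finset.sum_congr rfl fun i _ => ?_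
    have h1 : ⟪v, (star (b i) * b i) v⟫_ℂ = ⟪b i v, b i v⟫_ℂ :=
      ContinuousLinearMap.adjoint_inner_right (b i) v (b i v)
    rw [h1]
    exact inner_self_eq_norm_sq (𝕜 := ℂ) (b i v)
  obtain ⟨F, hFD, hFp, hF1, hF0⟩ := hD.exists_form_cut hrD hrsa τ
  have hFξ : ‖F ξ‖ ≤ ε / 2 := by
    have h1 := hF1 (F ξ) (by rw [← mul_apply_eq_comp, hFp.isIdempotentElem.eq])
    rw [hrform, hV.apply_apply hD hFD] at h1
    have h2 := (h1.trans (tailSq_amplification_le s (IsStarProjection.norm_le F hFp) _)).trans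
      (hs₀ s hs)
    exact le_of_sq_le_sq (le_of_mul_le_mul_left h2 hτ) (by positivity)
  obtain ⟨p, hpD, hpp, hpξ, hpm⟩ := hD.exists_cyclic_projection ξ
  obtain ⟨J, _, E, l, hE, hl⟩ := hD.exists_partition s (b := b) (fun i _ => hbD i) hε'
  have hF'D : 1 - F ∈ D := sub_mem (one_mem D) hFD
  have hfp := hep.mul_mem_masa hD heD hFp.one_sub hF'D
  have hfD : e * (1 - F) ∈ D := mul_mem heD hF'D
  have hgp := hfp.mul_mem_masa hD hfD hpp hpD
  have hgD : e * (1 - F) * p ∈ D := mul_mem hfD hpD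
  set g := e * (1 - F) * p with hg
  have hgξ : ‖ξ - g ξ‖ ≤ ε := by
    have h1 : ξ - g ξ = (1 - e) ξ + e (F ξ) := by
      simp only [hg, mul_apply_eq_comp, hpξ, sub_apply, one_apply_eq_self, map_sub]
      abel
    rw [h1]
    calc _ ≤ ‖(1 - e) ξ‖ + ‖e (F ξ)‖ := norm_add_le _ _
      _ ≤ ε / 2 + ε / 2 := add_le_add heξ ((hep.norm_apply_le _).trans hFξ)
      _ = ε := add_halves ε
  have hfam : IsProjFamily D (fun j => g * E j) :=
    { mem := fun j => mul_mem hgD (hE.mem j)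
      proj := fun j => hgp.mul_mem_masa hD hgD (hE.proj j) (hE.mem j)
      ortho := fun i j h => by
        rw [mul_assoc g, ← mul_assoc (E i), hD.1 _ (hE.mem i) _ hgD, mul_assoc g,
          hE.ortho i j h, mul_zero, mul_zero] }
  refine ⟨J, inferInstance, _, l, hfam, ?_, fun j v hv => ?_⟩
  · rw [← Finset.mul_sum, hE.sum_eq_one, mul_one]
    exact hgξ
  have hgv : g v = v := by
    rw [← hv, ← mul_apply_eq_comp, ← mul_assoc, hgp.isIdempotentElem.eq]
  have hEv : E j v = v := by
    rw [← hv, ← mul_apply_eq_comp, hD.1 _ hgD _ (hE.mem j), ← mul_assoc,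
      (hE.proj j).isIdempotentElem.eq]
  have hev : e v = v := by
    rw [← hgv, hg, ← mul_apply_eq_comp, ← mul_assoc, ← mul_assoc, hep.isIdempotentElem.eq]
  have hFv : F v = 0 := by
    rw [← hgv, hg, hD.1 _ heD _ hF'D, ← mul_apply_eq_comp, ← mul_assoc, ← mul_assoc,
      hFp.mul_one_sub_self, zero_mul, zero_mul]
    rfl
  refine ⟨?_, ?_, ?_, fun i hi => ?_⟩
  · have : v = p v := by
      nth_rw 2 [← hgv]
      rw [← mul_apply_eq_comp, hg, hD.1 _ hfD _ hpD, ← mul_assoc, hpp.isIdempotentElem.eq,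
        hD.1 _ hpD _ hfD]
      exact hgv.symm
    rw [this]
    exact hpm v
  · rw [← hform]
    exact he1 v hev
  · rw [← hrform]
    exact hF0 v hFv
  · have : V v i - l i j • v = ((b i - l i j • 1) * E j) v := by
      rw [mul_apply_eq_comp, hEv]
      rfl
    rw [this]
    exact ContinuousLinearMap.le_of_opNorm_le _ (hl i hi j) v

section Estimates

variable {E : Type*} [NormedAddCommGroup E] [InnerProductSpace ℂ E]

theorem norm_inner_sub_smul_inner_le {A : B E} {v v₁ w w₁ : E} {l m : ℂ} {ε : ℝ} (hε : ε ≤ 1)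
    (hv : ‖v₁ - l • v‖ ≤ ε * ‖v‖) (hv₁ : ‖v₁‖ ≤ ‖v‖) (hw : ‖w₁ - m • w‖ ≤ ε * ‖w‖)
    (hw₁ : ‖w₁‖ ≤ ‖w‖) :
    ‖⟪w₁, A v₁⟫_ℂ - star m * l * ⟪w, A v⟫_ℂ‖ ≤ 3 * ε * (‖A‖ * ‖v‖ * ‖w‖) := by
  have h1 : ⟪w₁, A v₁⟫_ℂ - star m * l * ⟪w, A v⟫_ℂ =
      ⟪w₁ - m • w, A v₁⟫_ℂ + ⟪m • w, A (v₁ - l • v)⟫_ℂ := by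
    rw [inner_sub_left, map_sub, inner_sub_right, map_smul, inner_smul_right, inner_smul_left,
      inner_smul_left]
    simp only [RCLike.star_def]
    ring
  have hmw : ‖m • w‖ ≤ 2 * ‖w‖ := by
    have : m • w = w₁ - (w₁ - m • w) := by abel
    rw [this]
    refine (norm_sub_le _ _).trans ?_
    nlinarith [norm_nonneg w]
  rw [h1]
  calc _ ≤ ‖w₁ - m • w‖ * ‖A v₁‖ + ‖m • w‖ * ‖A (v₁ - l • v)‖ :=
        (norm_add_le _ _).trans (add_le_add (norm_inner_le_norm _ _) (norm_inner_le_norm _ _))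
    _ ≤ (ε * ‖w‖) * (‖A‖ * ‖v‖) + (2 * ‖w‖) * (‖A‖ * (ε * ‖v‖)) := by
        have h2 : ‖A v₁‖ ≤ ‖A‖ * ‖v‖ := A.le_opNorm_of_le hv₁
        have h3 : ‖A (v₁ - l • v)‖ ≤ ‖A‖ * (ε * ‖v‖) := A.le_opNorm_of_le hv
        have h4 : 0 ≤ ε * ‖w‖ := (norm_nonneg _).trans hw
        gcongr
    _ = _ := by ring

theorem norm_inner_sub_sum_le {ι : Type*} (s : Finset ι) (g f : HilbertPower ι E) {t : ℝ}
    (ht : 0 ≤ t) (hg : tailSq s g ≤ t ^ 2) :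
    ‖⟪g, f⟫_ℂ - ∑ i ∈ s, ⟪g i, f i⟫_ℂ‖ ≤ t * ‖f‖ := by
  classical
  have h1 : ⟪g, f⟫_ℂ - ∑ i ∈ s, ⟪g i, f i⟫_ℂ = ⟪g - ∑ i ∈ s, lp.single 2 i (g i), f⟫_ℂ := by
    rw [inner_sub_left, sum_inner]
    congr 1
    exact Finset.sum_congr rfl fun i _ => (lp.inner_single_left i (g i) f).symm
  have h2 : ‖g - ∑ i ∈ s, lp.single 2 i (g i)‖ ≤ t := by
    refine le_of_sq_le_sq (le_trans (le_of_eq ?_) hg) ht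
    have := lp.norm_compl_sum_single (p := 2) (by norm_num) g s
    simpa [tailSq] using this
  rw [h1]
  refine (norm_inner_le_norm _ _).trans ?_
  gcongr

end Estimates

/-- On a rectangle where the graph operators are nearly scalar, an eigenvector of `Φ + id` forces
an approximate relation between the scalars. -/
theorem SchurHyper.IsSchurMultiplier.norm_mul_sub_sum_le {D : StarSubalgebra ℂ (B H)}
    (hD : IsMasa D) {Φ : B H →L[ℂ] B H} (hΦ : IsSchurMultiplier D Φ)
    {ι : Type} {i₀ : ι} {Ξ Y : HilbertPower ι H} {V W : H →L[ℂ] HilbertPower ι H}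
    (hV : IsGraphOperator D Ξ i₀ V) (hW : IsGraphOperator D Y i₀ W)
    (h : ∀ T : B H, ⟪Y i₀, (Φ T + T) (Ξ i₀)⟫_ℂ = ⟪Y, amplification T Ξ⟫_ℂ)
    {s : Finset ι} (hs : i₀ ∈ s) {p q : B H} {l m : ι → ℂ} {t ε : ℝ} (ht : 0 ≤ t) (hε₀ : 0 ≤ ε)
    (hε : ε ≤ 1) (hq : IsStarProjection q)
    (hqV : ∀ v, q v = v → v ∈ cyclicSubspace D (Ξ i₀) ∧
      ∀ i ∈ s, ‖V v i - l i • v‖ ≤ ε * ‖v‖)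
    (hpW : ∀ w, p w = w → w ∈ cyclicSubspace D (Y i₀) ∧
      tailSq s (W w) ≤ t ^ 2 * ‖w‖ ^ 2 ∧ ∀ i ∈ s, ‖W w i - m i • w‖ ≤ ε * ‖w‖)
    {y : B H} (hy0 : y ≠ 0) (hyp : p * y = y) (hyq : y * q = y) {c : ℂ} (hc : ‖c‖ ≤ 2)
    (hyc : Φ y + y = c • y) :
    ‖c * (star (m i₀) * l i₀) - ∑ i ∈ s, star (m i) * l i‖ ≤ t + 3 * ε * (s.card + 2) := by
  set K := c * (star (m i₀) * l i₀) - ∑ i ∈ s, star (m i) * l i with hK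
  set R := t + 3 * ε * (s.card + 2) with hR
  have hentry : ∀ {Z : HilbertPower ι H} {U : H →L[ℂ] HilbertPower ι H},
      IsGraphOperator D Z i₀ U → ∀ v i, ‖U v i‖ ≤ ‖v‖ := fun hU v i =>
    (lp.norm_apply_le_norm (by norm_num) _ i).trans (hU.norm_apply_le v)
  have key : ∀ v w, q v = v → p w = w → ‖K * ⟪w, y v⟫_ℂ‖ ≤ R * (‖y‖ * ‖v‖ * ‖w‖) := by
    intro v w hv hw
    obtain ⟨hvm, hvl⟩ := hqV v hv
    obtain ⟨hwm, hwt, hwl⟩ := hpW w hw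
    have hid := hΦ.inner_graphOperator hD hV hW h y hvm hwm
    rw [hyc, smul_apply, inner_smul_right] at hid
    have e1 := norm_inner_sub_smul_inner_le (A := y) hε (hvl i₀ hs) (hentry hV v i₀)
      (hwl i₀ hs) (hentry hW w i₀)
    have e2 := norm_inner_sub_sum_le s (W w) (amplification y (V v)) (t := t * ‖w‖)
      (by positivity) (by rwa [mul_pow])
    have e3 : ‖∑ i ∈ s, (⟪W w i, y (V v i)⟫_ℂ - star (m i) * l i * ⟪w, y v⟫_ℂ)‖ ≤
        s.card * (3 * ε * (‖y‖ * ‖v‖ * ‖w‖)) := by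
      refine (norm_sum_le_of_le _ fun i hi => ?_).trans_eq (by rw [Finset.sum_const, nsmul_eq_mul])
      exact norm_inner_sub_smul_inner_le hε (hvl i hi) (hentry hV v i) (hwl i hi) (hentry hW w i)
    have e4 : ‖amplification y (V v)‖ ≤ ‖y‖ * ‖v‖ :=
      (amplification y).le_of_opNorm_le_of_le (norm_amplification_le y) (hV.norm_apply_le v)
    have hKeq : K * ⟪w, y v⟫_ℂ =
        -(c * (⟪W w i₀, y (V v i₀)⟫_ℂ - star (m i₀) * l i₀ * ⟪w, y v⟫_ℂ)) +
        (⟪W w, amplification y (V v)⟫_ℂ - ∑ i ∈ s, ⟪W w i, amplification y (V v) i⟫_ℂ) +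
        ∑ i ∈ s, (⟪W w i, y (V v i)⟫_ℂ - star (m i) * l i * ⟪w, y v⟫_ℂ) := by
      rw [← hid, Finset.sum_sub_distrib, ← Finset.sum_mul, hK]
      simp only [amplification_apply]
      ring
    rw [hKeq]
    refine (norm_add₃_le).trans ?_
    rw [norm_neg, norm_mul]
    have e5 : ‖c‖ * ‖⟪W w i₀, y (V v i₀)⟫_ℂ - star (m i₀) * l i₀ * ⟪w, y v⟫_ℂ‖ ≤
        2 * (3 * ε * (‖y‖ * ‖v‖ * ‖w‖)) := by gcongr
    have e6 : t * ‖w‖ * ‖amplification y (V v)‖ ≤ t * ‖w‖ * (‖y‖ * ‖v‖) := by gcongr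
    calc _ ≤ 2 * (3 * ε * (‖y‖ * ‖v‖ * ‖w‖)) + t * ‖w‖ * (‖y‖ * ‖v‖) +
          s.card * (3 * ε * (‖y‖ * ‖v‖ * ‖w‖)) := add_le_add (add_le_add e5 (e2.trans e6)) e3
      _ = R * (‖y‖ * ‖v‖ * ‖w‖) := by rw [hR]; ring
  have hyq' : ∀ u, y (q u) = y u := fun u => congrArg (fun T : B H => T u) hyq
  have hyp' : ∀ u, p (y u) = y u := fun u => congrArg (fun T : B H => T u) hyp
  have hypos : 0 < ‖y‖ := norm_pos_iff.2 hy0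
  have hR0 : 0 ≤ R := by positivity
  have hbound : ∀ u, ‖(K • y) u‖ ≤ R * ‖y‖ * ‖u‖ := by
    intro u
    rw [smul_apply, norm_smul]
    rcases eq_or_ne (y u) 0 with hu | hu
    · rw [hu, norm_zero, mul_zero]
      positivity
    · have := key (q u) (y u) (by rw [← mul_apply_eq_comp, hq.isIdempotentElem.eq]) (hyp' u)
      rw [hyq', norm_mul, inner_self_eq_norm_sq_to_K, norm_pow, RCLike.norm_ofReal,
        abs_norm] at this
      refine le_of_mul_le_mul_right ?_ (norm_pos_iff.2 hu)
      calc ‖K‖ * ‖y u‖ * ‖y u‖ = ‖K‖ * ‖y u‖ ^ 2 := by ring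
        _ ≤ R * (‖y‖ * ‖q u‖ * ‖y u‖) := this
        _ ≤ R * (‖y‖ * ‖u‖ * ‖y u‖) := by gcongr; exact hq.norm_apply_le u
        _ = _ := by ring
  have h2 := (K • y).opNorm_le_bound (by positivity) hbound
  rw [norm_smul] at h2
  exact le_of_mul_le_mul_right h2 hypos

theorem IsGraphOperator.le_norm_scalar_add {D : StarSubalgebra ℂ (B H)} {ι : Type}
    {Ξ : HilbertPower ι H} {i₀ : ι} {V : H →L[ℂ] HilbertPower ι H}
    (hV : IsGraphOperator D Ξ i₀ V) {v : H} (hv : v ≠ 0) {δ ε : ℝ} {l : ℂ}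
    (hδ : δ * ‖v‖ ^ 2 ≤ ‖V v‖ ^ 2) (hl : ‖V v i₀ - l • v‖ ≤ ε * ‖v‖) : δ ≤ ‖l‖ + ε := by
  have h0 : 0 < ‖v‖ := norm_pos_iff.2 hv
  have h1 : ‖V v i₀‖ ≤ (‖l‖ + ε) * ‖v‖ := by
    have := norm_le_norm_add_norm_sub (l • v) (V v i₀)
    rw [norm_smul, norm_sub_rev] at this
    linarith
  refine le_of_mul_le_mul_right ?_ (pow_pos h0 2)
  calc _ ≤ ‖v‖ * ‖V v i₀‖ := hδ.trans (hV.norm_sq_apply_le v)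
    _ ≤ ‖v‖ * ((‖l‖ + ε) * ‖v‖) := by gcongr
    _ = _ := by ring

/-- Up to small projections, a Schur idempotent is a finite pattern of zeros and ones. -/
theorem SchurHyper.IsSchurIdempotent.exists_rectangles {D : StarSubalgebra ℂ (B H)}
    (hD : IsMasa D) {Φ : B H →L[ℂ] B H} (hΦ : IsSchurIdempotent D Φ) (η ξ : H) {ε : ℝ}
    (hε : 0 < ε) :
    ∃ (I J : Type) (_ : Fintype I) (_ : Fintype J) (p : I → B H) (q : J → B H),
      IsProjFamily D p ∧ IsProjFamily D q ∧
      ‖η - (∑ i, p i) η‖ ≤ ε ∧ ‖ξ - (∑ j, q j) ξ‖ ≤ ε ∧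
      ∀ i j, (∀ T, Φ (p i * T * q j) = p i * T * q j) ∨ ∀ T, Φ (p i * T * q j) = 0 := by
  classical
  obtain ⟨ι, i₀, Ξ, Y, rfl, rfl, hΞ, hY, hrep⟩ := hΦ.1.exists_representation hD η ξ
  obtain ⟨V, hV1, hV2, hV3, hV4⟩ := hD.exists_graph_operator Ξ i₀ hΞ
  obtain ⟨W, hW1, hW2, hW3, hW4⟩ := hD.exists_graph_operator Y i₀ hY
  have hV : IsGraphOperator D Ξ i₀ V := ⟨hV1, hV2, hV3, hV4⟩
  have hW : IsGraphOperator D Y i₀ W := ⟨hW1, hW2, hW3, hW4⟩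
  obtain ⟨δ, hδ, hVp⟩ := hV.exists_pieces hD hε
  obtain ⟨δ', hδ', hWp⟩ := hW.exists_pieces hD hε
  have ht : 0 < δ * δ' / 32 := by positivity
  obtain ⟨s₀, hVp⟩ := hVp 1 one_pos
  obtain ⟨s₁, hWp⟩ := hWp ((δ * δ' / 32) ^ 2) (by positivity)
  set s : Finset ι := insert i₀ (s₀ ∪ s₁) with hs
  have hi₀ : i₀ ∈ s := Finset.mem_insert_self _ _
  set ε' : ℝ := min (min 1 (δ * δ' / (96 * (s.card + 2)))) (min (δ / 2) (δ' / 2)) with hε'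
  have hε'0 : 0 < ε' := by positivity
  have hε'1 : ε' ≤ 1 := (min_le_left _ _).trans (min_le_left _ _)
  have hε'2 : ε' ≤ δ * δ' / (96 * (s.card + 2)) := (min_le_left _ _).trans (min_le_right _ _)
  have hε'3 : ε' ≤ δ / 2 := (min_le_right _ _).trans (min_le_left _ _)
  have hε'4 : ε' ≤ δ' / 2 := (min_le_right _ _).trans (min_le_right _ _)
  obtain ⟨J, _, q, l, hq, hqξ, hql⟩ := hVp s
    (Finset.subset_union_left.trans (Finset.subset_insert _ _)) ε' hε'0
  obtain ⟨I, _, p, m, hp, hpη, hpm⟩ := hWp s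
    (Finset.subset_union_right.trans (Finset.subset_insert _ _)) ε' hε'0
  refine ⟨I, J, inferInstance, inferInstance, p, q, hp, hq, hpη, hqξ, fun i j => ?_⟩
  have hbi : ∀ T, Φ (p i * T * q j) = p i * Φ T * q j := hΦ.1.2 _ (hp.mem i) _ (hq.mem j)
  have hpp : p i * p i = p i := (hp.proj i).isIdempotentElem.eq
  have hqq : q j * q j = q j := (hq.proj j).isIdempotentElem.eq
  have hcorner : ∀ T, p i * (p i * T * q j) = p i * T * q j ∧ p i * T * q j * q j = p i * T * q j :=
    fun T => ⟨by rw [← mul_assoc, ← mul_assoc, hpp], by rw [mul_assoc, hqq]⟩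
  have hidem : ∀ T, Φ (Φ T) = Φ T := fun T => congrArg (fun Ψ : B H →L[ℂ] B H => Ψ T) hΦ.2
  by_contra! hcon
  obtain ⟨⟨T, hT⟩, ⟨S, hS⟩⟩ := hcon
  have est : ∀ (y : B H) (c : ℂ), y ≠ 0 → p i * y = y → y * q j = y → ‖c‖ ≤ 2 → Φ y + y = c • y →
      ‖c * (star (m i₀ i) * l i₀ j) - ∑ k ∈ s, star (m k i) * l k j‖ ≤ δ * δ' / 16 := by
    intro y c h0 h1 h2 h3 h4
    have := hΦ.1.norm_mul_sub_sum_le hD hV hW hrep hi₀ (l := fun k => l k j)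
      (m := fun k => m k i) ht.le hε'0.le hε'1 (hq.proj j)
      (fun v hv => ⟨(hql j v hv).1, (hql j v hv).2.2.2⟩)
      (fun w hw => ⟨(hpm i w hw).1, (hpm i w hw).2.2⟩) h0 h1 h2 h3 h4
    have h5 : 3 * ε' * (s.card + 2) ≤ δ * δ' / 32 := by
      rw [le_div_iff₀ (by positivity)] at hε'2
      linarith
    linarith
  set y := Φ (p i * S * q j) with hy
  have hyp : p i * y = y := by rw [hy, hbi, (hcorner _).1]
  have hyq : y * q j = y := by rw [hy, hbi, (hcorner _).2]
  set z := p i * T * q j - Φ (p i * T * q j) with hz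
  have h1 := est y 2 hS hyp hyq (by simp) (by rw [hy, hidem, two_smul])
  have h2 := est z 1 (sub_ne_zero.2 (Ne.symm hT))
    (by rw [hz, hbi, mul_sub, (hcorner _).1, (hcorner _).1])
    (by rw [hz, hbi, sub_mul, (hcorner _).2, (hcorner _).2]) (by simp)
    (by rw [hz, map_sub, hidem, sub_self, zero_add, one_smul])
  obtain ⟨u, hu⟩ : ∃ u, y u ≠ 0 := by
    by_contra! hcon
    exact hS (ContinuousLinearMap.ext hcon)
  have hqu : q j u ≠ 0 := fun h => hu (by rw [← hyq, mul_apply_eq_comp, h, map_zero])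
  obtain ⟨-, hv2, -, hv4⟩ := hql j (q j u) (by rw [← mul_apply_eq_comp, hqq])
  obtain ⟨-, hw2, -, hw4⟩ := hpm i (y u) (by rw [← mul_apply_eq_comp, hyp])
  have h3 := hV.le_norm_scalar_add hqu hv2 (hv4 i₀ hi₀)
  have h4 := hW.le_norm_scalar_add hu hw2 (hw4 i₀ hi₀)
  have h5 : ‖star (m i₀ i) * l i₀ j‖ ≤ δ * δ' / 8 := by
    have := norm_sub_le
      (2 * (star (m i₀ i) * l i₀ j) - ∑ k ∈ s, star (m k i) * l k j)
      (1 * (star (m i₀ i) * l i₀ j) - ∑ k ∈ s, star (m k i) * l k j)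
    rw [show (2 * (star (m i₀ i) * l i₀ j) - ∑ k ∈ s, star (m k i) * l k j) -
      (1 * (star (m i₀ i) * l i₀ j) - ∑ k ∈ s, star (m k i) * l k j) =
      star (m i₀ i) * l i₀ j by ring] at this
    linarith
  rw [norm_mul, norm_star] at h5
  have h6 : δ' / 2 * (δ / 2) ≤ ‖m i₀ i‖ * ‖l i₀ j‖ := by
    gcongr <;> linarith
  linarith [mul_pos hδ hδ']

section Estimates

variable {E : Type*} [NormedAddCommGroup E] [InnerProductSpace ℂ E]

theorem norm_smul_add_smul_sq {e f : E} (he : ‖e‖ = 1) (hf : ‖f‖ = 1) (hef : ⟪e, f⟫_ℂ = 0)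
    (a b : ℂ) : ‖a • e + b • f‖ ^ 2 = ‖a‖ ^ 2 + ‖b‖ ^ 2 := by
  have h : ⟪a • e, b • f⟫_ℂ = 0 := by rw [inner_smul_left, inner_smul_right, hef]; simp
  have := norm_add_sq_eq_norm_sq_add_norm_sq_of_inner_eq_zero _ _ h
  simp only [norm_smul, he, hf, mul_one] at this
  linarith [sq ‖a • e + b • f‖, sq ‖a‖, sq ‖b‖]

theorem norm_inner_sq_add_norm_inner_sq_le {e f : E} (he : ‖e‖ = 1) (hf : ‖f‖ = 1)
    (hef : ⟪e, f⟫_ℂ = 0) (v : E) : ‖⟪e, v⟫_ℂ‖ ^ 2 + ‖⟪f, v⟫_ℂ‖ ^ 2 ≤ ‖v‖ ^ 2 := by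
  have ho : Orthonormal ℂ ![e, f] := by
    refine ⟨fun i => by fin_cases i <;> simp [he, hf], fun i j hij => ?_⟩
    have hfe : ⟪f, e⟫_ℂ = 0 := inner_eq_zero_symm.1 hef
    fin_cases i <;> fin_cases j <;> simp [hef, hfe] at hij ⊢
  simpa using ho.sum_inner_products_le (s := Finset.univ) (x := v)

end Estimates

theorem IsStarProjection.inner_eq_zero {P Q : B H} (hP : IsStarProjection P) (hPQ : P * Q = 0)
    {u v : H} (hu : P u = u) (hv : Q v = v) : ⟪u, v⟫_ℂ = 0 := by
  rw [← hu, hP.isSelfAdjoint.inner_apply_left, ← hv, ← mul_apply_eq_comp, hPQ]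
  simp

theorem IsStarProjection.exists_unit_vector {P : B H} (hP : IsStarProjection P) (h0 : P ≠ 0) :
    ∃ v, ‖v‖ = 1 ∧ P v = v := by
  obtain ⟨u, hu⟩ : ∃ u, P u ≠ 0 := by
    by_contra! hcon
    exact h0 (ContinuousLinearMap.ext hcon)
  refine ⟨((‖P u‖⁻¹ : ℝ) : ℂ) • P u, ?_, ?_⟩
  · rw [norm_smul, Complex.norm_real, norm_inv, norm_norm, inv_mul_cancel₀ (norm_ne_zero_iff.2 hu)]
  · rw [map_smul, ← mul_apply_eq_comp, hP.isIdempotentElem.eq]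

theorem IsStarProjection.mul_rankOne_mul {P Q : B H} (hQ : IsStarProjection Q) {e f : H}
    (he : P e = e) (hf : Q f = f) :
    P * InnerProductSpace.rankOne ℂ e f * Q = InnerProductSpace.rankOne ℂ e f := by
  ext v
  simp only [mul_apply_eq_comp, InnerProductSpace.rankOne_apply, map_smul, he]
  rw [← hQ.isSelfAdjoint.inner_apply_left, hf]

/-- A contractive pattern cannot contain three corners of a rectangle without the fourth one. -/
theorem apply_corner_ne_zero_of_norm_le_one {Φ : B H →L[ℂ] B H} (hc : ‖Φ‖ ≤ 1)
    {p₁ p₂ q₁ q₂ : B H} (hp₁ : IsStarProjection p₁) (hp₂ : IsStarProjection p₂)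
    (hq₁ : IsStarProjection q₁) (hq₂ : IsStarProjection q₂) (hp : p₁ * p₂ = 0) (hq : q₁ * q₂ = 0)
    (hp₁0 : p₁ ≠ 0) (hp₂0 : p₂ ≠ 0) (hq₁0 : q₁ ≠ 0) (hq₂0 : q₂ ≠ 0)
    (h₁₁ : ∀ T, Φ (p₁ * T * q₁) = p₁ * T * q₁) (h₁₂ : ∀ T, Φ (p₁ * T * q₂) = p₁ * T * q₂)
    (h₂₁ : ∀ T, Φ (p₂ * T * q₁) = p₂ * T * q₁) : ∃ T, Φ (p₂ * T * q₂) ≠ 0 := by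
  by_contra! h₂₂
  obtain ⟨e₁, he₁, hpe₁⟩ := hp₁.exists_unit_vector hp₁0
  obtain ⟨e₂, he₂, hpe₂⟩ := hp₂.exists_unit_vector hp₂0
  obtain ⟨f₁, hf₁, hqf₁⟩ := hq₁.exists_unit_vector hq₁0
  obtain ⟨f₂, hf₂, hqf₂⟩ := hq₂.exists_unit_vector hq₂0
  have he := hp₁.inner_eq_zero hp hpe₁ hpe₂
  have hf := hq₁.inner_eq_zero hq hqf₁ hqf₂
  set r : H → H → B H := fun e f => InnerProductSpace.rankOne ℂ e f with hr
  have hr_apply : ∀ e f v, r e f v = ⟪f, v⟫_ℂ • e := fun e f v =>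
    InnerProductSpace.rankOne_apply ..
  have k₁₁ : Φ (r e₁ f₁) = r e₁ f₁ := by
    have := h₁₁ (r e₁ f₁)
    rwa [hq₁.mul_rankOne_mul hpe₁ hqf₁] at this
  have k₁₂ : Φ (r e₁ f₂) = r e₁ f₂ := by
    have := h₁₂ (r e₁ f₂)
    rwa [hq₂.mul_rankOne_mul hpe₁ hqf₂] at this
  have k₂₁ : Φ (r e₂ f₁) = r e₂ f₁ := by
    have := h₂₁ (r e₂ f₁)
    rwa [hq₁.mul_rankOne_mul hpe₂ hqf₁] at this
  have k₂₂ : Φ (r e₂ f₂) = 0 := by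
    have := h₂₂ (r e₂ f₂)
    rwa [hq₂.mul_rankOne_mul hpe₂ hqf₂] at this
  set T : B H := r e₁ f₁ + r e₁ f₂ + r e₂ f₁ - r e₂ f₂ with hT
  have hΦT : Φ T = r e₁ f₁ + r e₁ f₂ + r e₂ f₁ := by
    rw [hT, map_sub, map_add, map_add, k₁₁, k₁₂, k₂₁, k₂₂, sub_zero]
  have hTn : ‖T‖ ≤ √2 := by
    refine T.opNorm_le_bound (by positivity) fun v => ?_
    have h1 : T v = (⟪f₁, v⟫_ℂ + ⟪f₂, v⟫_ℂ) • e₁ + (⟪f₁, v⟫_ℂ - ⟪f₂, v⟫_ℂ) • e₂ := by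
      simp only [hT, sub_apply, add_apply, hr_apply]
      module
    have h2 := norm_smul_add_smul_sq he₁ he₂ he (⟪f₁, v⟫_ℂ + ⟪f₂, v⟫_ℂ) (⟪f₁, v⟫_ℂ - ⟪f₂, v⟫_ℂ)
    have h3 := parallelogram_law_with_norm ℝ ⟪f₁, v⟫_ℂ ⟪f₂, v⟫_ℂ
    have h4 := norm_inner_sq_add_norm_inner_sq_le hf₁ hf₂ hf v
    rw [← h1] at h2
    refine le_of_sq_le_sq ?_ (by positivity)
    rw [mul_pow, Real.sq_sqrt (by norm_num)]
    nlinarith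
  have hf' : ⟪f₂, f₁⟫_ℂ = 0 := inner_eq_zero_symm.1 hf
  set v : H := (2 : ℂ) • f₁ + (1 : ℂ) • f₂ with hv
  have hi₁ : ⟪f₁, v⟫_ℂ = 2 := by
    rw [hv, inner_add_right, inner_smul_right, inner_smul_right, hf, inner_self_eq_norm_sq_to_K,
      hf₁]
    simp
  have hi₂ : ⟪f₂, v⟫_ℂ = 1 := by
    rw [hv, inner_add_right, inner_smul_right, inner_smul_right, hf', inner_self_eq_norm_sq_to_K,
      hf₂]
    simp
  have hvn : ‖v‖ ^ 2 = 5 := by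
    rw [hv, norm_smul_add_smul_sq hf₁ hf₂ hf]
    norm_num
  have hΦv : Φ T v = (3 : ℂ) • e₁ + (2 : ℂ) • e₂ := by
    rw [hΦT]
    simp only [add_apply, hr_apply, hi₁, hi₂]
    module
  have hΦvn : ‖Φ T v‖ ^ 2 = 13 := by
    rw [hΦv, norm_smul_add_smul_sq he₁ he₂ he]
    norm_num
  have hle : ‖Φ T v‖ ≤ √2 * ‖v‖ :=
    (Φ T).le_of_opNorm_le ((Φ.le_of_opNorm_le hc T).trans (by rwa [one_mul])) v
  have := pow_le_pow_left₀ (norm_nonneg _) hle 2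
  rw [mul_pow, Real.sq_sqrt (by norm_num), hvn, hΦvn] at this
  norm_num at this

section Estimates

variable {E : Type*} [NormedAddCommGroup E] [InnerProductSpace ℂ E]

theorem bddBelow_range_norm_sub (T : B E) (X : Set (B E)) (ξ : E) :
    BddBelow (Set.range fun S : X => ‖T ξ - S.1 ξ‖) :=
  ⟨0, by rintro _ ⟨S, rfl⟩; exact norm_nonneg _⟩

theorem arveson_nonneg (T : B E) (X : Set (B E)) : 0 ≤ arveson T X :=
  Real.iSup_nonneg fun _ => Real.iInf_nonneg fun _ => norm_nonneg _

theorem norm_apply_le_arveson_mul {T G : B E} {X : Set (B E)} (h0 : 0 ∈ X) (hG : ‖G‖ ≤ 1) {w : E}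
    (h : ∀ S ∈ X, G (S w) = 0) : ‖G (T w)‖ ≤ arveson T X * ‖w‖ := by
  have : Nonempty X := ⟨⟨0, h0⟩⟩
  rcases eq_or_ne w 0 with rfl | hw
  · simp
  have hw' : 0 < ‖w‖ := norm_pos_iff.2 hw
  set c : ℂ := ((‖w‖⁻¹ : ℝ) : ℂ) with hc
  have hcn : ‖c‖ = ‖w‖⁻¹ := by rw [hc, Complex.norm_real, norm_inv, norm_norm]
  have hu : ‖c • w‖ = 1 := by rw [norm_smul, hcn, inv_mul_cancel₀ hw'.ne']
  have h1 : ‖G (T (c • w))‖ ≤ ⨅ S : X, ‖T (c • w) - S.1 (c • w)‖ := by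
    refine le_ciInf fun S => ?_
    have h2 : G (T (c • w)) = G (T (c • w) - S.1 (c • w)) := by
      rw [map_sub, map_smul S.1, map_smul G, h S.1 S.2, smul_zero, sub_zero]
    rw [h2]
    simpa using G.le_of_opNorm_le hG (T (c • w) - S.1 (c • w))
  have hbdd : BddAbove (Set.range fun ξ : {ξ : E // ‖ξ‖ = 1} => ⨅ S : X, ‖T ξ.1 - S.1 ξ.1‖) := by
    refine ⟨‖T‖, ?_⟩
    rintro _ ⟨ξ, rfl⟩
    refine (ciInf_le (bddBelow_range_norm_sub T X ξ.1) ⟨0, h0⟩).trans ?_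
    simpa [ξ.2] using T.le_opNorm ξ.1
  have h3 : ‖G (T (c • w))‖ ≤ arveson T X := h1.trans (le_ciSup hbdd ⟨c • w, hu⟩)
  rw [map_smul, map_smul, norm_smul, hcn, inv_mul_le_iff₀ hw'] at h3
  rwa [mul_comm]

end Estimates

/-- A contractive pattern on finite families of projections is block diagonal. -/
theorem exists_labels {D : StarSubalgebra ℂ (B H)} {Φ : B H →L[ℂ] B H} (hc : ‖Φ‖ ≤ 1)
    {I J : Type} {p : I → B H} {q : J → B H} (hp : IsProjFamily D p) (hq : IsProjFamily D q)
    (h : ∀ i j, (∀ T, Φ (p i * T * q j) = p i * T * q j) ∨ ∀ T, Φ (p i * T * q j) = 0) :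
    ∃ (f : I → Set J) (g : J → Set J), ∀ i j,
      (f i = g j → ∀ T, Φ (p i * T * q j) = p i * T * q j) ∧
      (f i ≠ g j → ∀ T, Φ (p i * T * q j) = 0) := by
  set R : I → J → Prop := fun i j => ∃ T, Φ (p i * T * q j) ≠ 0 with hR
  have hRid : ∀ {i j}, R i j → ∀ T, Φ (p i * T * q j) = p i * T * q j := fun {i j} ⟨T, hT⟩ =>
    (h i j).resolve_right fun h0 => hT (h0 T)
  have hRp : ∀ {i j}, R i j → p i ≠ 0 := fun ⟨T, hT⟩ h0 => hT (by rw [h0]; simp)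
  have hRq : ∀ {i j}, R i j → q j ≠ 0 := fun ⟨T, hT⟩ h0 => hT (by rw [h0]; simp)
  have hrect : ∀ {i i' j j'}, R i j → R i j' → R i' j → R i' j' := by
    intro i i' j j' h1 h2 h3
    by_cases hi : i = i'
    · exact hi ▸ h2
    by_cases hj : j = j'
    · exact hj ▸ h3
    exact apply_corner_ne_zero_of_norm_le_one hc (hp.proj i) (hp.proj i') (hq.proj j) (hq.proj j')
      (hp.ortho _ _ hi) (hq.ortho _ _ hj) (hRp h1) (hRp h3) (hRq h1) (hRq h2) (hRid h1) (hRid h2)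
      (hRid h3)
  refine ⟨fun i => {j | R i j}, fun j => {j' | j' = j ∨ ∃ i, R i j ∧ R i j'}, fun i j =>
    ⟨fun hij => ?_, fun hij => ?_⟩⟩
  · have hRij : R i j := (Set.ext_iff.1 hij j).2 (.inl rfl)
    exact hRid hRij
  · by_contra! hcon
    have hRij : R i j := hcon
    refine hij (Set.ext fun j' => ⟨fun hj' => .inr ⟨i, hRij, hj'⟩, ?_⟩)
    rintro (rfl | ⟨i', h1, h2⟩)
    · exact hRij
    · exact hrect h1 h2 hRij

theorem IsProjFamily.isStarProjection_sum {D : StarSubalgebra ℂ (B H)} {J : Type} {e : J → B H}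
    (he : IsProjFamily D e) (s : Finset J) : IsStarProjection (∑ j ∈ s, e j) := by
  classical
  induction s using Finset.induction_on with
  | empty => simp
  | insert a s ha ih =>
    rw [Finset.sum_insert ha]
    refine (he.proj a).add ih ?_
    rw [Finset.mul_sum]
    exact Finset.sum_eq_zero fun j hj => he.ortho a j fun h => ha (h ▸ hj)

theorem IsProjFamily.sum_mul_sum_eq_zero {D : StarSubalgebra ℂ (B H)} {J : Type} {e : J → B H}
    (he : IsProjFamily D e) {s t : Finset J} (hst : Disjoint s t) :
    (∑ j ∈ s, e j) * ∑ j ∈ t, e j = 0 := by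
  rw [Finset.sum_mul_sum]
  exact Finset.sum_eq_zero fun i hi => Finset.sum_eq_zero fun j hj =>
    he.ortho i j fun h => Finset.disjoint_left.1 hst hi (h ▸ hj)

theorem IsStarProjection.norm_apply_add_sq {P Q : B H} (hP : IsStarProjection P)
    (hQ : IsStarProjection Q) (hPQ : P * Q = 0) (u v : H) :
    ‖P u + Q v‖ ^ 2 = ‖P u‖ ^ 2 + ‖Q v‖ ^ 2 := by
  have h : ⟪P u, Q v⟫_ℂ = 0 := hP.inner_eq_zero hPQ
    (by rw [← mul_apply_eq_comp, hP.isIdempotentElem.eq])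
    (by rw [← mul_apply_eq_comp, hQ.isIdempotentElem.eq])
  simpa only [sq] using norm_add_sq_eq_norm_sq_add_norm_sq_of_inner_eq_zero _ _ h

theorem norm_mul_mul_add_le {F₁ F₂ E₁ E₂ T : B H} (hF₁ : IsStarProjection F₁)
    (hF₂ : IsStarProjection F₂) (hE₁ : IsStarProjection E₁) (hE₂ : IsStarProjection E₂)
    (hF : F₁ * F₂ = 0) (hE : E₁ * E₂ = 0) {a : ℝ} (ha : 0 ≤ a)
    (h₁ : ∀ w, E₂ w = w → ‖F₁ (T w)‖ ≤ a * ‖w‖) (h₂ : ∀ w, E₁ w = w → ‖F₂ (T w)‖ ≤ a * ‖w‖) :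
    ‖F₁ * T * E₂ + F₂ * T * E₁‖ ≤ a := by
  refine ContinuousLinearMap.opNorm_le_bound _ ha fun v => ?_
  refine le_of_sq_le_sq ?_ (by positivity)
  have e1 := h₁ (E₂ v) (by rw [← mul_apply_eq_comp, hE₂.isIdempotentElem.eq])
  have e2 := h₂ (E₁ v) (by rw [← mul_apply_eq_comp, hE₁.isIdempotentElem.eq])
  have e3 := (hE₁.add hE₂ hE).norm_apply_le v
  rw [add_apply] at e3
  calc _ = ‖F₁ (T (E₂ v))‖ ^ 2 + ‖F₂ (T (E₁ v))‖ ^ 2 := hF₁.norm_apply_add_sq hF₂ hF _ _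
    _ ≤ (a * ‖E₂ v‖) ^ 2 + (a * ‖E₁ v‖) ^ 2 := by gcongr
    _ = a ^ 2 * ‖E₁ v + E₂ v‖ ^ 2 := by rw [hE₁.norm_apply_add_sq hE₂ hE]; ring
    _ ≤ a ^ 2 * ‖v‖ ^ 2 := by gcongr
    _ = _ := by ring

theorem sum_sign_mul_sign {L : Type*} [Fintype L] [DecidableEq L] (a b : L) :
    ∑ σ : L → ℤˣ, (((σ a * σ b : ℤˣ) : ℤ) : ℂ) =
      if a = b then (Fintype.card (L → ℤˣ) : ℂ) else 0 := by
  split_ifs with hab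
  · subst hab
    simp [Int.units_mul_self]
  · set u : L → ℤˣ := Pi.mulSingle a (-1) with hu
    have h := Equiv.sum_comp (Equiv.mulRight u)
      (fun σ : L → ℤˣ => (((σ a * σ b : ℤˣ) : ℤ) : ℂ))
    have hub : u b = 1 := Pi.mulSingle_eq_of_ne (Ne.symm hab) _
    have hua : u a = -1 := Pi.mulSingle_eq_same _ _
    simp only [Equiv.coe_mulRight, Pi.mul_apply, hua, hub, mul_one, mul_neg, neg_mul, Units.val_neg,
      Int.cast_neg, Finset.sum_neg_distrib] at h
    exact self_eq_neg.1 h.symm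

theorem norm_sum_mul_sub_mul_sum_le {D : StarSubalgebra ℂ (B H)} {Φ : B H →L[ℂ] B H}
    (hΦ : IsSchurIdempotent D Φ) (hc : ‖Φ‖ ≤ 1) {I J : Type} [Fintype I] [Fintype J]
    {p : I → B H} {q : J → B H} (hp : IsProjFamily D p) (hq : IsProjFamily D q)
    (h : ∀ i j, (∀ T, Φ (p i * T * q j) = p i * T * q j) ∨ ∀ T, Φ (p i * T * q j) = 0) (T : B H) :
    ‖(∑ i, p i) * (T - Φ T) * ∑ j, q j‖ ≤ 2 * arveson T (Set.range Φ) := by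
  classical
  obtain ⟨f, g, hfg⟩ := exists_labels hc hp hq h
  have hbi : ∀ i j S, Φ (p i * S * q j) = p i * Φ S * q j := fun i j S =>
    hΦ.1.2 _ (hp.mem i) _ (hq.mem j) S
  have h0 : (0 : B H) ∈ Set.range Φ := ⟨0, map_zero Φ⟩
  set U : (Set J → ℤˣ) → B H := fun σ => ∑ i, ((σ (f i) : ℤ) : ℂ) • p i with hU
  set V : (Set J → ℤˣ) → B H := fun σ => ∑ j, ((σ (g j) : ℤ) : ℂ) • q j with hV
  have hσ : ∀ σ, ‖(∑ i, p i) * T * (∑ j, q j) - U σ * T * V σ‖ ≤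
      2 * arveson T (Set.range Φ) := by
    intro σ
    set F : ℤˣ → Finset I := fun c => {i | σ (f i) = c} with hF
    set E : ℤˣ → Finset J := fun c => {j | σ (g j) = c} with hE
    have hsplit : ∀ {K : Type} [Fintype K] (k : K → Set J) (e : K → B H),
        ∑ x, e x = (∑ x with σ (k x) = 1, e x) + ∑ x with σ (k x) = -1, e x ∧
        ∑ x, ((σ (k x) : ℤ) : ℂ) • e x =
          (∑ x with σ (k x) = 1, e x) - ∑ x with σ (k x) = -1, e x := by
      intro K _ k e
      simp only [Finset.sum_filter, ← Finset.sum_add_distrib, ← Finset.sum_sub_distrib]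
      constructor <;> refine Finset.sum_congr rfl fun x _ => ?_ <;>
        rcases Int.units_eq_one_or (σ (k x)) with hx | hx <;> simp [hx]
    have hzero : ∀ c d, c ≠ d → ∀ S ∈ Set.range Φ,
        (∑ i ∈ F c, p i) * S * ∑ j ∈ E d, q j = 0 := by
      rintro c d hcd _ ⟨S, rfl⟩
      rw [Finset.sum_mul, Finset.sum_mul_sum]
      refine Finset.sum_eq_zero fun i hi => Finset.sum_eq_zero fun j hj => ?_
      rw [← hbi]
      refine (hfg i j).2 (fun hij => hcd ?_) S
      rw [← (Finset.mem_filter.1 hi).2, ← (Finset.mem_filter.1 hj).2, hij]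
    have hFp := fun c => hp.isStarProjection_sum (F c)
    have hEp := fun c => hq.isStarProjection_sum (E c)
    have hle : ∀ c d, c ≠ d → ∀ w, (∑ j ∈ E d, q j) w = w →
        ‖(∑ i ∈ F c, p i) (T w)‖ ≤ arveson T (Set.range Φ) * ‖w‖ := by
      intro c d hcd w hw
      refine norm_apply_le_arveson_mul h0 (IsStarProjection.norm_le _ (hFp c)) fun S hS => ?_
      have := congrArg (fun A : B H => A w) (hzero c d hcd S hS)
      simpa only [mul_apply_eq_comp, hw, zero_apply] using this
    have hdisj : ∀ {K : Type} [Fintype K] (k : K → Set J),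
        Disjoint (Finset.univ.filter fun x => σ (k x) = 1)
          (Finset.univ.filter fun x => σ (k x) = -1) := fun k =>
      Finset.disjoint_filter.2 fun x _ h1 h2 => absurd (h1.symm.trans h2) (by decide)
    have hmain := norm_mul_mul_add_le (hFp 1) (hFp (-1)) (hEp 1) (hEp (-1))
      (hp.sum_mul_sum_eq_zero (hdisj f)) (hq.sum_mul_sum_eq_zero (hdisj g))
      (arveson_nonneg T (Set.range Φ)) (hle 1 (-1) (by decide)) (hle (-1) 1 (by decide))
    have heq : (∑ i, p i) * T * (∑ j, q j) - U σ * T * V σ =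
        (2 : ℂ) • ((∑ i ∈ F 1, p i) * T * (∑ j ∈ E (-1), q j) +
          (∑ i ∈ F (-1), p i) * T * ∑ j ∈ E 1, q j) := by
      rw [hU, hV]
      simp only
      rw [(hsplit f p).1, (hsplit f p).2, (hsplit g q).1, (hsplit g q).2, two_smul]
      noncomm_ring
    rw [heq, norm_smul, Complex.norm_ofNat]
    gcongr
  set N : ℂ := (Fintype.card (Set J → ℤˣ) : ℂ) with hN
  have havg : N • ((∑ i, p i) * (T - Φ T) * ∑ j, q j) =
      ∑ σ, ((∑ i, p i) * T * (∑ j, q j) - U σ * T * V σ) := by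
    have h1 : ∑ σ, U σ * T * V σ = N • ((∑ i, p i) * Φ T * ∑ j, q j) := by
      simp only [hU, hV, Finset.sum_mul, Finset.mul_sum, Finset.smul_sum]
      rw [Finset.sum_comm]
      refine Finset.sum_congr rfl fun i _ => ?_
      rw [Finset.sum_comm]
      refine Finset.sum_congr rfl fun j _ => ?_
      have h2 : ∀ σ : Set J → ℤˣ, ((σ (f j) : ℤ) : ℂ) • p j * T * ((σ (g i) : ℤ) : ℂ) • q i =
          (((σ (f j) * σ (g i) : ℤˣ) : ℤ) : ℂ) • (p j * T * q i) := fun σ => by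
        rw [smul_mul_assoc, smul_mul_assoc, mul_smul_comm, smul_smul]
        push_cast
        rfl
      simp only [h2]
      rw [← Finset.sum_smul, sum_sign_mul_sign, ← hbi]
      split_ifs with hij
      · rw [(hfg j i).1 hij]
      · rw [(hfg j i).2 hij, zero_smul, smul_zero]
    rw [Finset.sum_sub_distrib, h1, Finset.sum_const, Finset.card_univ, ← Nat.cast_smul_eq_nsmul ℂ,
      ← smul_sub, ← sub_mul, ← mul_sub]
  have hNpos : 0 < ‖N‖ := by
    rw [norm_pos_iff, hN, Nat.cast_ne_zero]
    exact Fintype.card_ne_zero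
  refine le_of_mul_le_mul_left ?_ hNpos
  rw [← norm_smul, havg]
  refine (norm_sum_le_of_le _ fun σ _ => hσ σ).trans_eq ?_
  rw [Finset.sum_const, Finset.card_univ, nsmul_eq_mul, hN, Complex.norm_natCast]

/-- The distance estimate for contractive Schur idempotents. -/
theorem SchurHyper.IsSchurIdempotent.norm_sub_le_two_mul_arveson {D : StarSubalgebra ℂ (B H)}
    (hD : IsMasa D) {Φ : B H →L[ℂ] B H} (hΦ : IsSchurIdempotent D Φ) (hc : ‖Φ‖ ≤ 1) (T : B H) :
    ‖T - Φ T‖ ≤ 2 * arveson T (Set.range Φ) := by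
  set A := T - Φ T with hA
  set a := arveson T (Set.range Φ) with ha
  have ha0 : 0 ≤ a := arveson_nonneg _ _
  have key : ∀ η ξ, ‖⟪η, A ξ⟫_ℂ‖ ≤ 2 * a * ‖ξ‖ * ‖η‖ := by
    intro η ξ
    refine le_of_forall_pos_le_add fun ε hε => ?_
    set M := ‖A‖ * (‖ξ‖ + ‖η‖) + 1 with hM
    have hM0 : 0 < M := by positivity
    obtain ⟨I, J, _, _, p, q, hp, hq, hpη, hqξ, h⟩ :=
      hΦ.exists_rectangles hD η ξ (div_pos hε hM0)
    have hPQ := norm_sum_mul_sub_mul_sum_le hΦ hc hp hq h T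
    have hPp := hp.isStarProjection_sum Finset.univ
    set P := ∑ i, p i
    set Q := ∑ j, q j
    have hsplit : ⟪η, A ξ⟫_ℂ =
        ⟪η - P η, A ξ⟫_ℂ + ⟪P η, A (ξ - Q ξ)⟫_ℂ + ⟪η, (P * A * Q) ξ⟫_ℂ := by
      rw [mul_apply_eq_comp, mul_apply_eq_comp, ← hPp.isSelfAdjoint.inner_apply_left, map_sub,
        inner_sub_left, inner_sub_right]
      ring
    rw [hsplit]
    refine norm_add₃_le.trans ?_
    have e1 : ‖⟪η - P η, A ξ⟫_ℂ‖ ≤ ε / M * (‖A‖ * ‖ξ‖) :=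
      (norm_inner_le_norm _ _).trans (by gcongr; exact A.le_opNorm ξ)
    have e2 : ‖⟪P η, A (ξ - Q ξ)⟫_ℂ‖ ≤ ‖η‖ * (‖A‖ * (ε / M)) := by
      refine (norm_inner_le_norm _ _).trans ?_
      gcongr
      · exact hPp.norm_apply_le η
      · exact A.le_opNorm_of_le hqξ
    have e3 : ‖⟪η, (P * A * Q) ξ⟫_ℂ‖ ≤ ‖η‖ * (2 * a * ‖ξ‖) := by
      refine (norm_inner_le_norm _ _).trans ?_
      gcongr
      exact (P * A * Q).le_of_opNorm_le hPQ ξ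
    have e4 : ε / M * (‖A‖ * ‖ξ‖) + ‖η‖ * (‖A‖ * (ε / M)) ≤ ε := by
      calc _ = ε / M * (M - 1) := by rw [hM]; ring
        _ ≤ ε / M * M := by gcongr; linarith
        _ = ε := div_mul_cancel₀ _ hM0.ne'
    linarith
  refine A.opNorm_le_bound (by positivity) fun ξ => ?_
  rcases eq_or_ne (A ξ) 0 with h0 | h0
  · rw [h0, norm_zero]
    positivity
  · have := key (A ξ) ξ
    rw [inner_self_eq_norm_sq_to_K, norm_pow, RCLike.norm_ofReal, abs_norm, sq] at this
    exact le_of_mul_le_mul_right this (norm_pos_iff.2 h0)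

end

/-- every contractive Schur idempotent `Φ` belongs to `𝔉H` with
`λ(Φ) ≤ 2`, i.e. `‖T − Φ(T)‖ ≤ 2·α(T, ran Φ)` for all `T ∈ B(H)`. -/
theorem stmt6 {H : Type*} [NormedAddCommGroup H] [InnerProductSpace ℂ H] [CompleteSpace H]
    [TopologicalSpace.SeparableSpace H]
    (D : StarSubalgebra ℂ (B H)) (hD : IsMasa D)
    (Φ : B H →L[ℂ] B H) (hΦ : IsSchurIdempotent D Φ) (hc : ‖Φ‖ ≤ 1) :
    MemFH D Φ ∧ lam Φ ≤ 2 ∧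
    ∀ T : B H, ‖T - Φ T‖ ≤ 2 * arveson T (Set.range ⇑Φ) := by
  have h := hΦ.norm_sub_le_two_mul_arveson hD hc
  have hmem : (2 : ℝ) ∈ lamSet Φ := ⟨two_pos, h⟩
  exact ⟨⟨hΦ, 2, hmem⟩, csInf_le ⟨0, fun l hl => hl.1.le⟩ hmem, h⟩
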